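/- arXiv:nlin/0510014 — 11 statements merged into one kernel-verified Lean document; each statement's English description precedes it below -/
import Mathlib

section
/- Under the FDT data, the transformed functions satisfy the two evolution equations of the Toda lattice with N+1 self-consistent sources: v[1]_t = v[1]·(p[1]⁻ + Σ_{j=1}^{N+1} φ_{j-}[1]⁻ φ_{j+}[1]⁻) − v[1]·(p[1] + Σ_{j=1}^{N+1} φ_{j-}[1] φ_{j+}[1]) and p[1]_t = v[1]·(1 + Σ_{j=1}^{N+1} φ_{j-}[1]⁻ φ_{j+}[1]) − v[1]⁺·(1 + Σ_{j=1}^{N+1} φ_{j-}[1] φ_{j+}[1]⁺) hold at every (n,t) ∈ ℤ × ℝ. -/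
open Finset Real

/-- The operator `Δ⁻¹`: `(Δ⁻¹F)(n) = Σ_{m=0}^{n-1} F(m)` for `n ≥ 1`, `0` for `n = 0`,
`−Σ_{m=n}^{-1} F(m)` for `n ≤ −1`. -/
noncomputable def discSum (F : ℤ → ℝ) (n : ℤ) : ℝ :=
  if 0 ≤ n then ∑ m ∈ Finset.range n.toNat, F (m : ℤ)
  else -∑ m ∈ Finset.range (-n).toNat, F (n + (m : ℤ))

/-- Telescoping: `discSum` inverts the forward difference up to the value at `0`. -/
lemma discSum_add_apply_zero (F G : ℤ → ℝ) (hG : ∀ n, G (n + 1) - G n = F n) (n : ℤ) :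
    discSum F n + G 0 = G n := by
  unfold discSum
  split_ifs with hn
  · lift n to ℕ using hn
    have := Finset.sum_range_sub (fun m : ℕ => G m) n
    simp only [Nat.cast_add, Nat.cast_one, hG, Nat.cast_zero] at this
    simp [this]
  · obtain ⟨k, hk⟩ : ∃ k : ℕ, n = -(k : ℤ) := ⟨n.natAbs, by omega⟩
    have := Finset.sum_range_sub (fun m : ℕ => G (n + m)) k
    simp only [Nat.cast_add, Nat.cast_one, ← add_assoc, hG, Nat.cast_zero, add_zero] at this
    have hk' : (-n).toNat = k := by omega
    have h0 : n + (k : ℤ) = 0 := by omega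
    rw [hk', this, h0]
    ring

/-- The discrete Wronskian of two solutions of the adjoint lattice problems at spectral
parameters `μ` and `l` is, up to the factor `μ - l`, a primitive of their product. -/
lemma discSum_mul_add_wronskian (v p h φ : ℤ → ℝ) (μ l : ℝ) (hμ : μ ≠ l)
    (hh : ∀ n, v (n + 1) * h (n + 1) + p n * h n + h (n - 1) = μ * h n)
    (hφ : ∀ n, v n * φ (n - 1) + p n * φ n + φ (n + 1) = l * φ n) (n : ℤ) :
    discSum (fun m => h (m + 1) * φ (m + 1)) n + (μ - l)⁻¹ * (v 1 * h 1 * φ 0 - h 0 * φ 1)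
      = (μ - l)⁻¹ * (v (n + 1) * h (n + 1) * φ n - h n * φ (n + 1)) := by
  have hl : μ - l ≠ 0 := sub_ne_zero.mpr hμ
  refine discSum_add_apply_zero _
    (fun n => (μ - l)⁻¹ * (v (n + 1) * h (n + 1) * φ n - h n * φ (n + 1))) (fun m => ?_) n
  have h1 := hh (m + 1)
  have h2 := hφ (m + 1)
  simp only [add_sub_cancel_right] at h1 h2
  field_simp
  linear_combination φ (m + 1) * h1 - h (m + 1) * h2

/-- Product of a Darboux-transformed source pair at one site; `a` and `b` carry the values of
the auxiliary solution and of the source at consecutive sites. -/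
lemma transformed_source_mul {v₁ v₂ p₁ a₀ a₁ a₂ b₀ b₁ b₂ m₀ m₁ μ l : ℝ}
    (ha₀ : a₀ ≠ 0) (ha₁ : a₁ ≠ 0) (hμ : μ ≠ l)
    (ha : v₂ * a₂ + p₁ * a₁ + a₀ = μ * a₁) (hb : v₂ * b₂ + p₁ * b₁ + b₀ = l * b₁) :
    (μ - l)⁻¹ * (v₁ * a₁ * m₀ - a₀ * m₁) / a₀ * (b₀ - a₀ / a₁ * b₁)
      = m₁ * b₁ + (μ - l)⁻¹ * (v₂ * m₁ * (b₂ - b₁ * (a₂ / a₁)))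
        - (μ - l)⁻¹ * (v₁ * m₀ * (b₁ - b₀ * (a₁ / a₀))) := by
  have hl : μ - l ≠ 0 := sub_ne_zero.mpr hμ
  field_simp
  linear_combination a₀ * m₁ * b₁ * ha - a₀ * a₁ * m₁ * hb

/-- Product of a Darboux-transformed source pair at adjacent sites. -/
lemma transformed_source_mul_shift {v₁ v₂ p₁ a₀ a₁ a₂ b₀ b₁ b₂ m₀ m₁ μ l : ℝ}
    (ha₀ : a₀ ≠ 0) (ha₁ : a₁ ≠ 0) (ha₂ : a₂ ≠ 0) (hμ : μ ≠ l)
    (ha : v₂ * a₂ + p₁ * a₁ + a₀ = μ * a₁) (hb : v₂ * b₂ + p₁ * b₁ + b₀ = l * b₁) :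
    v₂ * a₂ * a₀ / a₁ ^ 2 *
        ((μ - l)⁻¹ * (v₁ * a₁ * m₀ - a₀ * m₁) / a₀ * (b₁ - a₁ / a₂ * b₂))
      = v₁ * m₀ * b₁ + a₀ / a₁ * ((μ - l)⁻¹ * (v₂ * m₁ * (b₂ - b₁ * (a₂ / a₁)))
        - (μ - l)⁻¹ * (v₁ * m₀ * (b₁ - b₀ * (a₁ / a₀)))) := by
  have hl : μ - l ≠ 0 := sub_ne_zero.mpr hμ
  field_simp
  linear_combination (v₁ * a₁ * m₀) * (b₁ * ha - a₁ * hb)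

/-- under the FDT data, the transformed functions
`v[1], p[1], φ_{j±}[1]` (j = 1,…,N+1) satisfy the two evolution equations of
the Toda lattice with `N+1` self-consistent sources at every `(n,t)`. -/
theorem fdt_evolution_equations
    (N : ℕ) (v p : ℤ → ℝ → ℝ) (φp φm : ℕ → ℤ → ℝ → ℝ) (lam : ℕ → ℝ)
    (vt pt : ℤ → ℝ → ℝ) (φpt φmt : ℕ → ℤ → ℝ → ℝ)
    (hdist : ∀ i < N, ∀ j < N, i ≠ j → lam i ≠ lam j)
    (hvt : ∀ n t, HasDerivAt (fun s => v n s) (vt n t) t)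
    (hpt : ∀ n t, HasDerivAt (fun s => p n s) (pt n t) t)
    (hφpt : ∀ j < N, ∀ n t, HasDerivAt (fun s => φp j n s) (φpt j n t) t)
    (hφmt : ∀ j < N, ∀ n t, HasDerivAt (fun s => φm j n s) (φmt j n t) t)
    -- the TLSCS system with N sources
    (heq1 : ∀ n t, vt n t =
      v n t * (p (n - 1) t + ∑ j ∈ range N, φm j (n - 1) t * φp j (n - 1) t)
        - v n t * (p n t + ∑ j ∈ range N, φm j n t * φp j n t))
    (heq2 : ∀ n t, pt n t =
      v n t * (1 + ∑ j ∈ range N, φm j (n - 1) t * φp j n t)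
        - v (n + 1) t * (1 + ∑ j ∈ range N, φm j n t * φp j (n + 1) t))
    (heq3 : ∀ j < N, ∀ n t,
      v (n + 1) t * φp j (n + 1) t + p n t * φp j n t + φp j (n - 1) t
        = lam j * φp j n t)
    (heq4 : ∀ j < N, ∀ n t,
      v n t * φm j (n - 1) t + p n t * φm j n t + φm j (n + 1) t
        = lam j * φm j n t)
    -- eigenfunctions f, g of the Lax pair at λ = μ
    (μ : ℝ) (hμ : ∀ j < N, μ ≠ lam j)
    (f g : ℤ → ℝ → ℝ) (ft gt : ℤ → ℝ → ℝ)
    (hft : ∀ n t, HasDerivAt (fun s => f n s) (ft n t) t)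
    (hgt : ∀ n t, HasDerivAt (fun s => g n s) (gt n t) t)
    (hfS : ∀ n t, v (n + 1) t * f (n + 1) t + p n t * f n t + f (n - 1) t = μ * f n t)
    (hfT : ∀ n t, -(ft n t) = v (n + 1) t * f (n + 1) t
      + ∑ j ∈ range N, (μ - lam j)⁻¹ *
          (v (n + 1) t * φm j n t * (φp j (n + 1) t * f n t - φp j n t * f (n + 1) t)))
    (hgS : ∀ n t, v (n + 1) t * g (n + 1) t + p n t * g n t + g (n - 1) t = μ * g n t)
    (hgT : ∀ n t, -(gt n t) = v (n + 1) t * g (n + 1) t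
      + ∑ j ∈ range N, (μ - lam j)⁻¹ *
          (v (n + 1) t * φm j n t * (φp j (n + 1) t * g n t - φp j n t * g (n + 1) t)))
    -- the combination h = f + α g, nonvanishing
    (α αd : ℝ → ℝ) (hα : ∀ t, α t ≠ 0) (hαd : ∀ t, HasDerivAt α (αd t) t)
    (c d : ℝ → ℝ) (cd dd : ℝ → ℝ)
    (hc : ∀ t, HasDerivAt c (cd t) t) (hd : ∀ t, HasDerivAt d (dd t) t)
    (hcdval : ∀ t, c t * d t = -(αd t) / α t)
    (h : ℤ → ℝ → ℝ) (hdef : ∀ n t, h n t = f n t + α t * g n t)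
    (hne : ∀ n t, h n t ≠ 0)
    -- the transformed quantities
    (V1 P1 : ℤ → ℝ → ℝ) (Φp Φm : ℕ → ℤ → ℝ → ℝ) (κ : ℕ → ℝ → ℝ)
    (hV1 : ∀ n t, V1 n t = v (n + 1) t * h (n + 1) t * h (n - 1) t / (h n t) ^ 2)
    (hP1 : ∀ n t, P1 n t = p n t - h n t / h (n + 1) t + h (n - 1) t / h n t)
    (hκ : ∀ i < N, ∀ t, κ i t = (μ - lam i)⁻¹ *
      (v 1 t * h 1 t * φm i 0 t - h 0 t * φm i 1 t))
    (hΦp : ∀ i < N, ∀ n t, Φp i n t = φp i n t - h n t / h (n + 1) t * φp i (n + 1) t)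
    (hΦm : ∀ i < N, ∀ n t, Φm i n t =
      (discSum (fun m => h (m + 1) t * φm i (m + 1) t) n + κ i t) / h n t)
    (hΦpN : ∀ n t, Φp N n t = c t * (f n t - h n t / h (n + 1) t * f (n + 1) t))
    (hΦmN : ∀ n t, Φm N n t = d t / h n t) :
    ∀ n : ℤ, ∀ t : ℝ,
      (deriv (fun s => V1 n s) t =
        V1 n t * (P1 (n - 1) t + ∑ j ∈ range (N + 1), Φm j (n - 1) t * Φp j (n - 1) t)
          - V1 n t * (P1 n t + ∑ j ∈ range (N + 1), Φm j n t * Φp j n t)) ∧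
      (deriv (fun s => P1 n s) t =
        V1 n t * (1 + ∑ j ∈ range (N + 1), Φm j (n - 1) t * Φp j n t)
          - V1 (n + 1) t * (1 + ∑ j ∈ range (N + 1), Φm j n t * Φp j (n + 1) t)) := by
  have hhS : ∀ n t, v (n + 1) t * h (n + 1) t + p n t * h n t + h (n - 1) t = μ * h n t := by
    intro n t
    simp only [hdef]
    linear_combination hfS n t + α t * hgS n t
  intro n t
  -- `r j` is the contribution of the `j`-th source to `R`, and `-R` the logarithmic
  -- derivative of `h`
  obtain ⟨r, hr⟩ : ∃ r : ℕ → ℤ → ℝ, ∀ j n, r j n = (μ - lam j)⁻¹ *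
      (v (n + 1) t * φm j n t * (φp j (n + 1) t - φp j n t * (h (n + 1) t / h n t))) :=
    ⟨_, fun _ _ => rfl⟩
  obtain ⟨R, hR⟩ : ∃ R : ℤ → ℝ, ∀ n, R n = v (n + 1) t * h (n + 1) t / h n t
      + ∑ j ∈ range N, r j n - αd t * g n t / h n t := ⟨_, fun _ => rfl⟩
  have hht : ∀ n, HasDerivAt (fun s => h n s) (-(R n * h n t)) t := by
    intro n
    have e : (fun s => h n s) = fun s => f n s + α s * g n s := funext (hdef n)
    rw [e]
    refine ((hft n t).add ((hαd t).mul (hgt n t))).congr_deriv ?_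
    have hsum : (∑ j ∈ range N, r j n) * h n t =
        (∑ j ∈ range N, (μ - lam j)⁻¹ *
          (v (n + 1) t * φm j n t * (φp j (n + 1) t * f n t - φp j n t * f (n + 1) t)))
        + α t * ∑ j ∈ range N, (μ - lam j)⁻¹ *
          (v (n + 1) t * φm j n t * (φp j (n + 1) t * g n t - φp j n t * g (n + 1) t)) := by
      rw [sum_mul, mul_sum, ← sum_add_distrib]
      refine sum_congr rfl fun j _ => ?_
      have h0 := hne n t
      have e1 : h (n + 1) t / h n t * h n t = h (n + 1) t := by field_simp
      rw [hr]
      linear_combination (μ - lam j)⁻¹ * v (n + 1) t * φm j n t *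
        (φp j (n + 1) t * hdef n t - φp j n t * hdef (n + 1) t - φp j n t * e1)
    have e2 : R n * h n t = v (n + 1) t * h (n + 1) t
        + (∑ j ∈ range N, r j n) * h n t - αd t * g n t := by
      have h0 := hne n t
      rw [hR]
      field_simp
    rw [e2, hsum]
    linear_combination -hfT n t - α t * hgT n t + v (n + 1) t * hdef (n + 1) t
  have hΦm' : ∀ j < N, ∀ n, Φm j n t = (μ - lam j)⁻¹ *
      (v (n + 1) t * h (n + 1) t * φm j n t - h n t * φm j (n + 1) t) / h n t := by
    intro j hj n
    rw [hΦm j hj, hκ j hj]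
    congr 1
    exact discSum_mul_add_wronskian (fun n => v n t) (fun n => p n t) (fun n => h n t)
      (fun n => φm j n t) μ (lam j) (hμ j hj) (fun n => hhS n t) (fun n => heq4 j hj n t) n
  have hcd : c t * d t * α t = -αd t := by
    rw [hcdval, div_mul_cancel₀ _ (hα t)]
  have hA : ∀ n, P1 n t + ∑ j ∈ range (N + 1), Φm j n t * Φp j n t =
      p (n + 1) t + (∑ j ∈ range N, φm j (n + 1) t * φp j (n + 1) t) + R (n + 1) - R n := by
    intro n
    have hsum : ∑ j ∈ range N, Φm j n t * Φp j n t =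
        (∑ j ∈ range N, φm j (n + 1) t * φp j (n + 1) t) + ∑ j ∈ range N, r j (n + 1)
          - ∑ j ∈ range N, r j n := by
      rw [← sum_add_distrib, ← sum_sub_distrib]
      refine sum_congr rfl fun j hj => ?_
      have hj := mem_range.mp hj
      have hS := hhS (n + 1) t
      have hb := heq3 j hj (n + 1) t
      rw [add_sub_cancel_right] at hS hb
      rw [hΦm' j hj, hΦp j hj, hr, hr]
      exact transformed_source_mul (hne _ _) (hne _ _) (hμ j hj) hS hb
    have hN : Φm N n t * Φp N n t =
        -αd t * (g (n + 1) t / h (n + 1) t - g n t / h n t) := by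
      have h0 := hne n t
      have h1 := hne (n + 1) t
      rw [hΦmN, hΦpN, ← hcd]
      field_simp
      linear_combination c t * d t * (h n t * hdef (n + 1) t - h (n + 1) t * hdef n t)
    have e0 : v (n + 1) t * h (n + 1) t / h n t = μ - p n t - h (n - 1) t / h n t := by
      have h0 := hne n t
      field_simp
      linear_combination hhS n t
    have e1 : v (n + 1 + 1) t * h (n + 1 + 1) t / h (n + 1) t
        = μ - p (n + 1) t - h n t / h (n + 1) t := by
      have h0 := hne (n + 1) t
      have hS := hhS (n + 1) t
      rw [add_sub_cancel_right] at hS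
      field_simp
      linear_combination hS
    rw [sum_range_succ, hsum, hN, hP1, hR, hR, e0, e1]
    ring
  have hB : ∀ n, V1 n t * (1 + ∑ j ∈ range (N + 1), Φm j (n - 1) t * Φp j n t) =
      v n t * (1 + ∑ j ∈ range N, φm j (n - 1) t * φp j n t)
        + h (n - 1) t / h n t * (R n - R (n - 1)) := by
    intro n
    have hm := hne (n - 1) t
    have h0 := hne n t
    have h1 := hne (n + 1) t
    have hsum : V1 n t * ∑ j ∈ range N, Φm j (n - 1) t * Φp j n t =
        v n t * (∑ j ∈ range N, φm j (n - 1) t * φp j n t)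
          + h (n - 1) t / h n t * (∑ j ∈ range N, r j n - ∑ j ∈ range N, r j (n - 1)) := by
      rw [← sum_sub_distrib, mul_sum, mul_sum, mul_sum, ← sum_add_distrib]
      refine sum_congr rfl fun j hj => ?_
      have hj := mem_range.mp hj
      rw [hV1, hΦm' j hj, hΦp j hj, hr, hr, sub_add_cancel, ← mul_assoc (v n t) (φm j (n - 1) t)]
      exact transformed_source_mul_shift hm h0 h1 (hμ j hj) (hhS n t) (heq3 j hj n t)
    have hN : V1 n t * (Φm N (n - 1) t * Φp N n t) =
        -αd t * (h (n - 1) t / h n t) * (g n t / h n t - g (n - 1) t / h (n - 1) t) := by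
      have key : Φm N (n - 1) t * Φp N n t =
          -αd t * (g (n + 1) t * h n t - g n t * h (n + 1) t) / (h (n - 1) t * h (n + 1) t) := by
        rw [hΦmN, hΦpN, ← hcd]
        field_simp
        linear_combination c t * d t * (h n t * hdef (n + 1) t - h (n + 1) t * hdef n t)
      rw [key, hV1]
      field_simp
      linear_combination -αd t * (h n t * hgS n t - g n t * hhS n t)
    rw [sum_range_succ, mul_add, mul_add, hsum, hN, hR, hR, sub_add_cancel, hV1]
    field_simp
    ring
  constructor
  · have e : (fun s => V1 n s) =
        fun s => v (n + 1) s * h (n + 1) s * h (n - 1) s / (h n s) ^ 2 := funext (hV1 n)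
    have hder := (((hvt (n + 1) t).fun_mul (hht (n + 1))).fun_mul (hht (n - 1))).fun_div
      ((hht n).fun_pow 2) (pow_ne_zero 2 (hne n t))
    have h0 := hne n t
    rw [e, hder.deriv, hA, hA, heq1, hV1]
    simp only [sub_add_cancel, add_sub_cancel_right]
    field_simp
    ring
  · have e : (fun s => P1 n s) =
        fun s => p n s - h n s / h (n + 1) s + h (n - 1) s / h n s := funext (hP1 n)
    have hder := ((hpt n t).fun_sub ((hht n).fun_div (hht (n + 1)) (hne _ t))).fun_add
      ((hht (n - 1)).fun_div (hht n) (hne _ t))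
    have h0 := hne n t
    have h1 := hne (n + 1) t
    have hB1 := hB (n + 1)
    simp only [add_sub_cancel_right] at hB1
    rw [e, hder.deriv, hB, hB1, heq2]
    field_simp
    ring
end

section
/- Under the FDT data, for each i = 1,…,N the transformed source φ_{i+}[1] = φ_{i+} − (h/h⁺) φ_{i+}⁺ satisfies the transformed discrete spectral problem with eigenvalue λ_i: v[1]⁺ φ_{i+}[1]⁺ + p[1] φ_{i+}[1] + φ_{i+}[1]⁻ = λ_i φ_{i+}[1] at every (n,t) ∈ ℤ × ℝ. -/
open Finset Real

/-- The algebraic core of the Darboux transformation for the Toda spectral problem: `a, b, c, d`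
are four consecutive values of a nonvanishing solution at `μ`, and `x, y, z, w` those of a
solution at `l`. -/
theorem toda_darboux_identity {u V p q μ l a b c d x y z w : ℝ}
    (hb : b ≠ 0) (hc : c ≠ 0) (hd : d ≠ 0)
    (hh₀ : u * c + p * b + a = μ * b) (hh₁ : V * d + q * c + b = μ * c)
    (hφ₀ : u * z + p * y + x = l * y) (hφ₁ : V * w + q * z + y = l * z) :
    V * d * b / c ^ 2 * (z - c / d * w) + (p - b / c + a / b) * (y - b / c * z)
      + (x - a / b * y) = l * (y - b / c * z) := by
  have hV : V * d * b / c ^ 2 * (z - c / d * w) = V * d * b * z / c ^ 2 - V * b * w / c := by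
    field_simp
  have hab : a / b * (b / c * z) = a / c * z := by
    field_simp
  have hcc : c * c⁻¹ = 1 := mul_inv_cancel₀ hc
  rw [hV]
  linear_combination (b * z / c ^ 2) * hh₁ - (b / c) * hφ₁ + hφ₀ - (z / c) * hh₀ - hab
    + (z * u + (μ - q) * z * b * c⁻¹) * hcc

/-- under the FDT data, for each `i = 1,…,N` the transformed
source `φ_{i+}[1] = φ_{i+} − (h/h⁺) φ_{i+}⁺` satisfies the transformed discrete
spectral problem with eigenvalue `λ_i`:
`v[1]⁺ φ_{i+}[1]⁺ + p[1] φ_{i+}[1] + φ_{i+}[1]⁻ = λ_i φ_{i+}[1]`. -/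
theorem fdt_transformed_source_spectral
    (N : ℕ) (v p : ℤ → ℝ → ℝ) (φp φm : ℕ → ℤ → ℝ → ℝ) (lam : ℕ → ℝ)
    (vt pt : ℤ → ℝ → ℝ) (φpt φmt : ℕ → ℤ → ℝ → ℝ)
    (hdist : ∀ i < N, ∀ j < N, i ≠ j → lam i ≠ lam j)
    (hvt : ∀ n t, HasDerivAt (fun s => v n s) (vt n t) t)
    (hpt : ∀ n t, HasDerivAt (fun s => p n s) (pt n t) t)
    (hφpt : ∀ j < N, ∀ n t, HasDerivAt (fun s => φp j n s) (φpt j n t) t)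
    (hφmt : ∀ j < N, ∀ n t, HasDerivAt (fun s => φm j n s) (φmt j n t) t)
    -- the TLSCS system with N sources
    (heq1 : ∀ n t, vt n t =
      v n t * (p (n - 1) t + ∑ j ∈ range N, φm j (n - 1) t * φp j (n - 1) t)
        - v n t * (p n t + ∑ j ∈ range N, φm j n t * φp j n t))
    (heq2 : ∀ n t, pt n t =
      v n t * (1 + ∑ j ∈ range N, φm j (n - 1) t * φp j n t)
        - v (n + 1) t * (1 + ∑ j ∈ range N, φm j n t * φp j (n + 1) t))
    (heq3 : ∀ j < N, ∀ n t,
      v (n + 1) t * φp j (n + 1) t + p n t * φp j n t + φp j (n - 1) t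
        = lam j * φp j n t)
    (heq4 : ∀ j < N, ∀ n t,
      v n t * φm j (n - 1) t + p n t * φm j n t + φm j (n + 1) t
        = lam j * φm j n t)
    -- eigenfunctions f, g of the Lax pair at λ = μ
    (μ : ℝ) (hμ : ∀ j < N, μ ≠ lam j)
    (f g : ℤ → ℝ → ℝ) (ft gt : ℤ → ℝ → ℝ)
    (hft : ∀ n t, HasDerivAt (fun s => f n s) (ft n t) t)
    (hgt : ∀ n t, HasDerivAt (fun s => g n s) (gt n t) t)
    (hfS : ∀ n t, v (n + 1) t * f (n + 1) t + p n t * f n t + f (n - 1) t = μ * f n t)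
    (hfT : ∀ n t, -(ft n t) = v (n + 1) t * f (n + 1) t
      + ∑ j ∈ range N, (μ - lam j)⁻¹ *
          (v (n + 1) t * φm j n t * (φp j (n + 1) t * f n t - φp j n t * f (n + 1) t)))
    (hgS : ∀ n t, v (n + 1) t * g (n + 1) t + p n t * g n t + g (n - 1) t = μ * g n t)
    (hgT : ∀ n t, -(gt n t) = v (n + 1) t * g (n + 1) t
      + ∑ j ∈ range N, (μ - lam j)⁻¹ *
          (v (n + 1) t * φm j n t * (φp j (n + 1) t * g n t - φp j n t * g (n + 1) t)))
    -- the combination h = f + α g, nonvanishing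
    (α αd : ℝ → ℝ) (hα : ∀ t, α t ≠ 0) (hαd : ∀ t, HasDerivAt α (αd t) t)
    (h : ℤ → ℝ → ℝ) (hdef : ∀ n t, h n t = f n t + α t * g n t)
    (hne : ∀ n t, h n t ≠ 0)
    -- the transformed quantities
    (V1 P1 : ℤ → ℝ → ℝ) (Φp : ℕ → ℤ → ℝ → ℝ)
    (hV1 : ∀ n t, V1 n t = v (n + 1) t * h (n + 1) t * h (n - 1) t / (h n t) ^ 2)
    (hP1 : ∀ n t, P1 n t = p n t - h n t / h (n + 1) t + h (n - 1) t / h n t)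
    (hΦp : ∀ i < N, ∀ n t, Φp i n t = φp i n t - h n t / h (n + 1) t * φp i (n + 1) t) :
    ∀ i < N, ∀ n : ℤ, ∀ t : ℝ,
      V1 (n + 1) t * Φp i (n + 1) t + P1 n t * Φp i n t + Φp i (n - 1) t
        = lam i * Φp i n t := by
  intro i hi n t
  have hS : ∀ m, v (m + 1) t * h (m + 1) t + p m t * h m t + h (m - 1) t = μ * h m t := by
    intro m
    simp only [hdef]
    linear_combination hfS m t + α t * hgS m t
  have hh₁ := hS (n + 1)
  have hφ₁ := heq3 i hi (n + 1) t
  rw [hV1, hP1, hΦp i hi, hΦp i hi, hΦp i hi]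
  simp only [add_sub_cancel_right, sub_add_cancel] at hh₁ hφ₁ ⊢
  exact toda_darboux_identity (hne n t) (hne (n + 1) t) (hne (n + 1 + 1) t)
    (hS n) hh₁ (heq3 i hi n t) hφ₁
end

section
/- Under the FDT data, for each i = 1,…,N the transformed adjoint source φ_{i-}[1](n,t) = (Δ⁻¹E(h φ_{i-})(n,t) + κ_i(t))/h(n,t) satisfies the transformed adjoint spectral problem with eigenvalue λ_i: v[1] φ_{i-}[1]⁻ + p[1] φ_{i-}[1] + φ_{i-}[1]⁺ = λ_i φ_{i-}[1] at every (n,t) ∈ ℤ × ℝ. -/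
open Finset Real

theorem discSum_zero (F : ℤ → ℝ) : discSum F 0 = 0 := by
  simp [discSum]

theorem discSum_add_one (F : ℤ → ℝ) (n : ℤ) : discSum F (n + 1) = discSum F n + F n := by
  unfold discSum
  rcases le_or_gt 0 n with hn | hn
  · lift n to ℕ using hn
    rw [if_pos (by omega), if_pos (by omega), show ((n : ℤ) + 1).toNat = n + 1 by omega,
      Finset.sum_range_succ, Int.toNat_natCast]
  · obtain ⟨k, rfl⟩ : ∃ k : ℕ, n = -((k : ℤ) + 1) := ⟨(-n - 1).toNat, by omega⟩
    rw [if_neg (not_le.2 hn), show (-(-((k : ℤ) + 1))).toNat = k + 1 by omega,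
      Finset.sum_range_succ']
    rcases Nat.eq_zero_or_pos k with rfl | hk
    · simp
    · rw [if_neg (by omega), show (-(-((k : ℤ) + 1) + 1)).toNat = k by omega]
      have hs : ∀ m : ℕ, -((k : ℤ) + 1) + 1 + (m : ℤ) = -((k : ℤ) + 1) + ((m + 1 : ℕ) : ℤ) := by
        intro m
        push_cast
        ring
      simp only [hs]
      simp

/-- A function is recovered from its forward difference and its value at `0`. -/
theorem discSum_add_eq_of_sub_eq {F W : ℤ → ℝ} (hW : ∀ n, W (n + 1) - W n = F n) (n : ℤ) :
    discSum F n + W 0 = W n := by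
  induction n using Int.induction_on with
  | zero => simp [discSum_zero]
  | succ k ih => linarith [discSum_add_one F k, hW k]
  | pred k ih =>
    have h1 := discSum_add_one F (-(k : ℤ) - 1)
    have h2 := hW (-(k : ℤ) - 1)
    rw [sub_add_cancel] at h1 h2
    linarith

/-- under the FDT data, for each `i = 1,…,N` the transformed
adjoint source `φ_{i-}[1] = (Δ⁻¹E(h φ_{i-}) + κ_i)/h` satisfies the transformed
adjoint spectral problem with eigenvalue `λ_i`:
`v[1] φ_{i-}[1]⁻ + p[1] φ_{i-}[1] + φ_{i-}[1]⁺ = λ_i φ_{i-}[1]`. -/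
theorem fdt_transformed_adjoint_source_spectral
    (N : ℕ) (v p : ℤ → ℝ → ℝ) (φp φm : ℕ → ℤ → ℝ → ℝ) (lam : ℕ → ℝ)
    (vt pt : ℤ → ℝ → ℝ) (φpt φmt : ℕ → ℤ → ℝ → ℝ)
    (hdist : ∀ i < N, ∀ j < N, i ≠ j → lam i ≠ lam j)
    (hvt : ∀ n t, HasDerivAt (fun s => v n s) (vt n t) t)
    (hpt : ∀ n t, HasDerivAt (fun s => p n s) (pt n t) t)
    (hφpt : ∀ j < N, ∀ n t, HasDerivAt (fun s => φp j n s) (φpt j n t) t)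
    (hφmt : ∀ j < N, ∀ n t, HasDerivAt (fun s => φm j n s) (φmt j n t) t)
    -- the TLSCS system with N sources
    (heq1 : ∀ n t, vt n t =
      v n t * (p (n - 1) t + ∑ j ∈ range N, φm j (n - 1) t * φp j (n - 1) t)
        - v n t * (p n t + ∑ j ∈ range N, φm j n t * φp j n t))
    (heq2 : ∀ n t, pt n t =
      v n t * (1 + ∑ j ∈ range N, φm j (n - 1) t * φp j n t)
        - v (n + 1) t * (1 + ∑ j ∈ range N, φm j n t * φp j (n + 1) t))
    (heq3 : ∀ j < N, ∀ n t,
      v (n + 1) t * φp j (n + 1) t + p n t * φp j n t + φp j (n - 1) t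
        = lam j * φp j n t)
    (heq4 : ∀ j < N, ∀ n t,
      v n t * φm j (n - 1) t + p n t * φm j n t + φm j (n + 1) t
        = lam j * φm j n t)
    -- eigenfunctions f, g of the Lax pair at λ = μ
    (μ : ℝ) (hμ : ∀ j < N, μ ≠ lam j)
    (f g : ℤ → ℝ → ℝ) (ft gt : ℤ → ℝ → ℝ)
    (hft : ∀ n t, HasDerivAt (fun s => f n s) (ft n t) t)
    (hgt : ∀ n t, HasDerivAt (fun s => g n s) (gt n t) t)
    (hfS : ∀ n t, v (n + 1) t * f (n + 1) t + p n t * f n t + f (n - 1) t = μ * f n t)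
    (hfT : ∀ n t, -(ft n t) = v (n + 1) t * f (n + 1) t
      + ∑ j ∈ range N, (μ - lam j)⁻¹ *
          (v (n + 1) t * φm j n t * (φp j (n + 1) t * f n t - φp j n t * f (n + 1) t)))
    (hgS : ∀ n t, v (n + 1) t * g (n + 1) t + p n t * g n t + g (n - 1) t = μ * g n t)
    (hgT : ∀ n t, -(gt n t) = v (n + 1) t * g (n + 1) t
      + ∑ j ∈ range N, (μ - lam j)⁻¹ *
          (v (n + 1) t * φm j n t * (φp j (n + 1) t * g n t - φp j n t * g (n + 1) t)))
    -- the combination h = f + α g, nonvanishing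
    (α αd : ℝ → ℝ) (hα : ∀ t, α t ≠ 0) (hαd : ∀ t, HasDerivAt α (αd t) t)
    (h : ℤ → ℝ → ℝ) (hdef : ∀ n t, h n t = f n t + α t * g n t)
    (hne : ∀ n t, h n t ≠ 0)
    -- the transformed quantities
    (V1 P1 : ℤ → ℝ → ℝ) (Φm : ℕ → ℤ → ℝ → ℝ) (κ : ℕ → ℝ → ℝ)
    (hV1 : ∀ n t, V1 n t = v (n + 1) t * h (n + 1) t * h (n - 1) t / (h n t) ^ 2)
    (hP1 : ∀ n t, P1 n t = p n t - h n t / h (n + 1) t + h (n - 1) t / h n t)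
    (hκ : ∀ i < N, ∀ t, κ i t = (μ - lam i)⁻¹ *
      (v 1 t * h 1 t * φm i 0 t - h 0 t * φm i 1 t))
    (hΦm : ∀ i < N, ∀ n t, Φm i n t =
      (discSum (fun m => h (m + 1) t * φm i (m + 1) t) n + κ i t) / h n t) :
    ∀ i < N, ∀ n : ℤ, ∀ t : ℝ,
      V1 n t * Φm i (n - 1) t + P1 n t * Φm i n t + Φm i (n + 1) t
        = lam i * Φm i n t := by
  intro i hi n t
  have hc : μ - lam i ≠ 0 := sub_ne_zero.2 (hμ i hi)
  have hS : ∀ n, v (n + 1) t * h (n + 1) t + p n t * h n t + h (n - 1) t = μ * h n t := by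
    intro n
    simp only [hdef]
    linear_combination hfS n t + α t * hgS n t
  -- the summand is the forward difference of the Casoratian-type quantity `W`
  set W : ℤ → ℝ := fun m =>
    (μ - lam i)⁻¹ * (v (m + 1) t * h (m + 1) t * φm i m t - h m t * φm i (m + 1) t) with hWdef
  have hW : ∀ m, W (m + 1) - W m = h (m + 1) t * φm i (m + 1) t := by
    intro m
    have h1 := hS (m + 1)
    have h2 := heq4 i hi (m + 1) t
    rw [add_sub_cancel_right] at h1 h2
    simp only [hWdef]
    field_simp
    linear_combination φm i (m + 1) t * h1 - h (m + 1) t * h2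
  have hΦ : ∀ m, Φm i m t = W m / h m t := by
    intro m
    rw [hΦm i hi, ← discSum_add_eq_of_sub_eq hW m, hκ i hi]
    simp [hWdef]
  have hWn : (μ - lam i) * W n
      = v (n + 1) t * h (n + 1) t * φm i n t - h n t * φm i (n + 1) t := by
    simp only [hWdef]
    rw [mul_inv_cancel_left₀ hc]
  have hprev : W (n - 1) = W n - h n t * φm i n t := by
    have := hW (n - 1)
    rw [sub_add_cancel] at this
    linarith
  have hnext : W (n + 1) = W n + h (n + 1) t * φm i (n + 1) t := by linarith [hW n]
  have h0 := hne n t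
  have h1 := hne (n + 1) t
  have h2 := hne (n - 1) t
  rw [hV1, hP1, hΦ, hΦ, hΦ, hprev, hnext]
  generalize W n = w at hWn ⊢
  have hSn := hS n
  field_simp
  linear_combination h (n + 1) t * w * hSn + h (n + 1) t * h n t * hWn
end

section
/- Under the FDT data, the new source pair satisfies the transformed spectral problems with eigenvalue λ_{N+1} = μ: namely φ_{N+1,+}[1] = c(t)(f − (h/h⁺) f⁺) satisfies v[1]⁺ φ_{N+1,+}[1]⁺ + p[1] φ_{N+1,+}[1] + φ_{N+1,+}[1]⁻ = μ φ_{N+1,+}[1], and φ_{N+1,-}[1] = d(t)/h satisfies v[1] φ_{N+1,-}[1]⁻ + p[1] φ_{N+1,-}[1] + φ_{N+1,-}[1]⁺ = μ φ_{N+1,-}[1], at every (n,t) ∈ ℤ × ℝ. -/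
open Finset Real

/-- under the FDT data, the new source pair satisfies the
transformed spectral problems with eigenvalue `λ_{N+1} = μ`:
`φ_{N+1,+}[1] = c(t)(f − (h/h⁺) f⁺)` satisfies
`v[1]⁺ φ_{N+1,+}[1]⁺ + p[1] φ_{N+1,+}[1] + φ_{N+1,+}[1]⁻ = μ φ_{N+1,+}[1]` and
`φ_{N+1,-}[1] = d(t)/h` satisfies
`v[1] φ_{N+1,-}[1]⁻ + p[1] φ_{N+1,-}[1] + φ_{N+1,-}[1]⁺ = μ φ_{N+1,-}[1]`. -/
theorem fdt_new_source_pair_spectral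
    (N : ℕ) (v p : ℤ → ℝ → ℝ) (φp φm : ℕ → ℤ → ℝ → ℝ) (lam : ℕ → ℝ)
    (vt pt : ℤ → ℝ → ℝ) (φpt φmt : ℕ → ℤ → ℝ → ℝ)
    (hdist : ∀ i < N, ∀ j < N, i ≠ j → lam i ≠ lam j)
    (hvt : ∀ n t, HasDerivAt (fun s => v n s) (vt n t) t)
    (hpt : ∀ n t, HasDerivAt (fun s => p n s) (pt n t) t)
    (hφpt : ∀ j < N, ∀ n t, HasDerivAt (fun s => φp j n s) (φpt j n t) t)
    (hφmt : ∀ j < N, ∀ n t, HasDerivAt (fun s => φm j n s) (φmt j n t) t)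
    -- the TLSCS system with N sources
    (heq1 : ∀ n t, vt n t =
      v n t * (p (n - 1) t + ∑ j ∈ range N, φm j (n - 1) t * φp j (n - 1) t)
        - v n t * (p n t + ∑ j ∈ range N, φm j n t * φp j n t))
    (heq2 : ∀ n t, pt n t =
      v n t * (1 + ∑ j ∈ range N, φm j (n - 1) t * φp j n t)
        - v (n + 1) t * (1 + ∑ j ∈ range N, φm j n t * φp j (n + 1) t))
    (heq3 : ∀ j < N, ∀ n t,
      v (n + 1) t * φp j (n + 1) t + p n t * φp j n t + φp j (n - 1) t
        = lam j * φp j n t)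
    (heq4 : ∀ j < N, ∀ n t,
      v n t * φm j (n - 1) t + p n t * φm j n t + φm j (n + 1) t
        = lam j * φm j n t)
    -- eigenfunctions f, g of the Lax pair at λ = μ
    (μ : ℝ) (hμ : ∀ j < N, μ ≠ lam j)
    (f g : ℤ → ℝ → ℝ) (ft gt : ℤ → ℝ → ℝ)
    (hft : ∀ n t, HasDerivAt (fun s => f n s) (ft n t) t)
    (hgt : ∀ n t, HasDerivAt (fun s => g n s) (gt n t) t)
    (hfS : ∀ n t, v (n + 1) t * f (n + 1) t + p n t * f n t + f (n - 1) t = μ * f n t)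
    (hfT : ∀ n t, -(ft n t) = v (n + 1) t * f (n + 1) t
      + ∑ j ∈ range N, (μ - lam j)⁻¹ *
          (v (n + 1) t * φm j n t * (φp j (n + 1) t * f n t - φp j n t * f (n + 1) t)))
    (hgS : ∀ n t, v (n + 1) t * g (n + 1) t + p n t * g n t + g (n - 1) t = μ * g n t)
    (hgT : ∀ n t, -(gt n t) = v (n + 1) t * g (n + 1) t
      + ∑ j ∈ range N, (μ - lam j)⁻¹ *
          (v (n + 1) t * φm j n t * (φp j (n + 1) t * g n t - φp j n t * g (n + 1) t)))
    -- the combination h = f + α g, nonvanishing, and the functions c, d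
    (α αd : ℝ → ℝ) (hα : ∀ t, α t ≠ 0) (hαd : ∀ t, HasDerivAt α (αd t) t)
    (c d : ℝ → ℝ) (cd dd : ℝ → ℝ)
    (hc : ∀ t, HasDerivAt c (cd t) t) (hd : ∀ t, HasDerivAt d (dd t) t)
    (hcdval : ∀ t, c t * d t = -(αd t) / α t)
    (h : ℤ → ℝ → ℝ) (hdef : ∀ n t, h n t = f n t + α t * g n t)
    (hne : ∀ n t, h n t ≠ 0)
    -- the transformed quantities
    (V1 P1 ΦpN ΦmN : ℤ → ℝ → ℝ)
    (hV1 : ∀ n t, V1 n t = v (n + 1) t * h (n + 1) t * h (n - 1) t / (h n t) ^ 2)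
    (hP1 : ∀ n t, P1 n t = p n t - h n t / h (n + 1) t + h (n - 1) t / h n t)
    (hΦpN : ∀ n t, ΦpN n t = c t * (f n t - h n t / h (n + 1) t * f (n + 1) t))
    (hΦmN : ∀ n t, ΦmN n t = d t / h n t) :
    ∀ n : ℤ, ∀ t : ℝ,
      (V1 (n + 1) t * ΦpN (n + 1) t + P1 n t * ΦpN n t + ΦpN (n - 1) t
        = μ * ΦpN n t) ∧
      (V1 n t * ΦmN (n - 1) t + P1 n t * ΦmN n t + ΦmN (n + 1) t
        = μ * ΦmN n t) := by
  intro n t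
  have hhS : ∀ m, v (m + 1) t * h (m + 1) t + p m t * h m t + h (m - 1) t = μ * h m t := by
    intro m
    simp only [hdef]
    linear_combination hfS m t + α t * hgS m t
  have h₀ := hne n t
  have h₁ := hne (n + 1) t
  have h₂ := hne (n + 1 + 1) t
  have hm := hne (n - 1) t
  have hS := hhS n
  have hS' := hhS (n + 1)
  have fS := hfS n t
  have fS' := hfS (n + 1) t
  simp only [add_sub_cancel_right] at hS' fS'
  simp only [hV1, hP1, hΦpN, hΦmN, add_sub_cancel_right, sub_add_cancel]
  constructor
  · have shifted : v (n + 1 + 1) t * h (n + 1 + 1) t * h n t / h (n + 1) t ^ 2 *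
        (c t * (f (n + 1) t - h (n + 1) t / h (n + 1 + 1) t * f (n + 1 + 1) t)) =
        h n t / h (n + 1) t * (c t * (f n t - h n t / h (n + 1) t * f (n + 1) t)) := by
      field_simp
      linear_combination c t * (f (n + 1) t * hS' - h (n + 1) t * fS')
    rw [shifted]
    field_simp
    linear_combination c t * h (n + 1) t * h n t * (h (n + 1) t * fS - f (n + 1) t * hS)
  · field_simp
    linear_combination d t * h (n + 1) t * hS
end

section
/- Let v, p : ℤ × ℝ → ℝ, let λ, μ ∈ ℝ, let h : ℤ × ℝ → ℝ satisfy v⁺ h⁺ + p h + h⁻ = μ h with h(n,t) ≠ 0 for all (n,t), and let ψ : ℤ × ℝ → ℝ satisfy v⁺ ψ⁺ + p ψ + ψ⁻ = λ ψ. Then ψ[1] = ψ − (h/h⁺) ψ⁺ satisfies the transformed spectral problem v[1]⁺ ψ[1]⁺ + p[1] ψ[1] + ψ[1]⁻ = λ ψ[1] at every (n,t), where v[1] = v⁺ h⁺ h⁻ / h² and p[1] = p − h/h⁺ + h⁻/h. -/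
/-- spectral part of the forward Darboux transformation for the
discrete isospectral problem `v⁺ ψ⁺ + p ψ + ψ⁻ = λ ψ` of the Toda lattice.
If `h` solves the spectral problem with eigenvalue `μ` and is nonvanishing, and `ψ`
solves it with eigenvalue `λ`, then `ψ[1] = ψ − (h/h⁺) ψ⁺` solves the transformed
spectral problem with `v[1] = v⁺ h⁺ h⁻ / h²`, `p[1] = p − h/h⁺ + h⁻/h`. -/
theorem fdt_spectral_one_step
    (v p h ψ : ℤ → ℝ → ℝ) (lam μ : ℝ)
    (hh : ∀ n : ℤ, ∀ t : ℝ,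
      v (n + 1) t * h (n + 1) t + p n t * h n t + h (n - 1) t = μ * h n t)
    (hne : ∀ n : ℤ, ∀ t : ℝ, h n t ≠ 0)
    (hψ : ∀ n : ℤ, ∀ t : ℝ,
      v (n + 1) t * ψ (n + 1) t + p n t * ψ n t + ψ (n - 1) t = lam * ψ n t)
    (V1 P1 Ψ1 : ℤ → ℝ → ℝ)
    (hV1 : ∀ n t, V1 n t = v (n + 1) t * h (n + 1) t * h (n - 1) t / (h n t) ^ 2)
    (hP1 : ∀ n t, P1 n t = p n t - h n t / h (n + 1) t + h (n - 1) t / h n t)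
    (hΨ1 : ∀ n t, Ψ1 n t = ψ n t - h n t / h (n + 1) t * ψ (n + 1) t) :
    ∀ n : ℤ, ∀ t : ℝ,
      V1 (n + 1) t * Ψ1 (n + 1) t + P1 n t * Ψ1 n t + Ψ1 (n - 1) t
        = lam * Ψ1 n t := by
  intro n t
  have hh1 := hh (n + 1) t
  have hψ1 := hψ (n + 1) t
  rw [add_sub_cancel_right] at hh1 hψ1
  rw [hV1, hP1, hΨ1, hΨ1, hΨ1, add_sub_cancel_right, sub_add_cancel]
  have h0 := hne n t
  have h1 := hne (n + 1) t
  have h2 := hne (n + 1 + 1) t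
  linear_combination (norm := skip)
    ψ (n + 1) t * h n t / h (n + 1) t ^ 2 * hh1 - ψ (n + 1) t / h (n + 1) t * hh n t
      + hψ n t - h n t / h (n + 1) t * hψ1
  field_simp
  ring
end

section
/- Under the FDT data, if ψ is an eigenfunction of the Lax pair of the original solution at a spectral parameter λ with λ ∉ {λ_1,…,λ_N, μ}, then ψ[1] = ψ − (h/h⁺) ψ⁺ satisfies the time-evolution equation of the Lax pair of the transformed (N+1)-source system: −ψ[1]_t = v[1]⁺ ψ[1]⁺ + Σ_{j=1}^{N+1} (λ − λ_j)^{-1} v[1]⁺ φ_{j-}[1] (φ_{j+}[1]⁺ ψ[1] − φ_{j+}[1] ψ[1]⁺) at every (n,t) ∈ ℤ × ℝ, where λ_{N+1} = μ. -/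
open Finset Real

/-- A primitive of `F` is `discSum F` up to its value at `0`. -/
theorem discSum_add_eq {F G : ℤ → ℝ} (hG : ∀ n, G (n + 1) = G n + F n) (n : ℤ) :
    discSum F n + G 0 = G n := by
  induction n using Int.induction_on with
  | zero => simp [discSum_zero]
  | succ k ih => rw [discSum_add_one, hG, ← ih]; ring
  | pred k ih =>
    have h1 := discSum_add_one F (-(k : ℤ) - 1)
    have h2 := hG (-(k : ℤ) - 1)
    rw [sub_add_cancel] at h1 h2
    linarith

/-- Closed form of `Δ⁻¹E(h φ)` for `h` and `φ` solving the spectral problem and its adjoint. -/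
theorem discSum_mul_add_eq {v p h φ : ℤ → ℝ} {μ a : ℝ} (hμ : μ ≠ a)
    (hh : ∀ n, v (n + 1) * h (n + 1) + p n * h n + h (n - 1) = μ * h n)
    (hφ : ∀ n, v n * φ (n - 1) + p n * φ n + φ (n + 1) = a * φ n) (n : ℤ) :
    discSum (fun m => h (m + 1) * φ (m + 1)) n + (μ - a)⁻¹ * (v 1 * h 1 * φ 0 - h 0 * φ 1)
      = (μ - a)⁻¹ * (v (n + 1) * h (n + 1) * φ n - h n * φ (n + 1)) := by
  have hμa : μ - a ≠ 0 := sub_ne_zero.mpr hμ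
  refine discSum_add_eq
    (G := fun n => (μ - a)⁻¹ * (v (n + 1) * h (n + 1) * φ n - h n * φ (n + 1))) (fun n => ?_) n
  have h1 := hh (n + 1)
  have h2 := hφ (n + 1)
  rw [add_sub_cancel_right] at h1 h2
  field_simp
  linear_combination φ (n + 1) * h1 - h (n + 1) * h2

/-- The Wronskian-type expression of two Darboux-transformed eigenfunctions, in terms of the
original ones. -/
theorem darboux_wronskian {v₂ p₁ h₀ h₁ h₂ x₀ x₁ x₂ y₀ y₁ y₂ μ a b : ℝ}
    (h1 : h₁ ≠ 0) (h2 : h₂ ≠ 0)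
    (hh : v₂ * h₂ + p₁ * h₁ + h₀ = μ * h₁) (hx : v₂ * x₂ + p₁ * x₁ + x₀ = a * x₁)
    (hy : v₂ * y₂ + p₁ * y₁ + y₀ = b * y₁) :
    v₂ * h₂ * h₀ / h₁ ^ 2 * ((x₁ - h₁ / h₂ * x₂) * (y₀ - h₀ / h₁ * y₁)
        - (x₀ - h₀ / h₁ * x₁) * (y₁ - h₁ / h₂ * y₂))
      = h₀ / h₁ ^ 2 * ((μ - a) * x₁ * (y₀ * h₁ - h₀ * y₁)
        - (μ - b) * y₁ * (x₀ * h₁ - h₀ * x₁)) := by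
  have hX : v₂ * h₂ * (x₁ - h₁ / h₂ * x₂) = (μ - a) * h₁ * x₁ + (x₀ * h₁ - h₀ * x₁) := by
    field_simp
    linear_combination x₁ * hh - h₁ * hx
  have hY : v₂ * h₂ * (y₁ - h₁ / h₂ * y₂) = (μ - b) * h₁ * y₁ + (y₀ * h₁ - h₀ * y₁) := by
    field_simp
    linear_combination y₁ * hh - h₁ * hy
  have hW : v₂ * h₂ * h₀ / h₁ ^ 2 * ((x₁ - h₁ / h₂ * x₂) * (y₀ - h₀ / h₁ * y₁)
        - (x₀ - h₀ / h₁ * x₁) * (y₁ - h₁ / h₂ * y₂))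
      = h₀ / h₁ ^ 2 * (v₂ * h₂ * (x₁ - h₁ / h₂ * x₂) * (y₀ - h₀ / h₁ * y₁)
        - (x₀ - h₀ / h₁ * x₁) * (v₂ * h₂ * (y₁ - h₁ / h₂ * y₂))) := by ring
  rw [hW, hX, hY]
  field_simp
  ring

/-- The contribution of a single source to the time evolution of a Darboux-transformed
eigenfunction. -/
theorem darboux_source_term {v₁ v₂ p₁ h₀ h₁ h₂ x₀ x₁ x₂ y₀ y₁ y₂ m₀ m₁ μ a b : ℝ}
    (h0 : h₀ ≠ 0) (h1 : h₁ ≠ 0) (h2 : h₂ ≠ 0) (hμ : μ ≠ a) (hb : b ≠ a)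
    (hh : v₂ * h₂ + p₁ * h₁ + h₀ = μ * h₁) (hx : v₂ * x₂ + p₁ * x₁ + x₀ = a * x₁)
    (hy : v₂ * y₂ + p₁ * y₁ + y₀ = b * y₁) :
    (b - a)⁻¹ * (v₂ * h₂ * h₀ / h₁ ^ 2 * ((μ - a)⁻¹ * (v₁ * h₁ * m₀ - h₀ * m₁) / h₀)
        * ((x₁ - h₁ / h₂ * x₂) * (y₀ - h₀ / h₁ * y₁)
          - (x₀ - h₀ / h₁ * x₁) * (y₁ - h₁ / h₂ * y₂)))
      = (b - a)⁻¹ * (v₁ * m₀ * (x₁ * y₀ - x₀ * y₁))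
        - y₁ / h₁ * ((μ - a)⁻¹ * (v₁ * m₀ * (x₁ * h₀ - x₀ * h₁)))
        + h₀ * y₁ / h₁ ^ 2 * ((μ - a)⁻¹ * (v₂ * m₁ * (x₂ * h₁ - x₁ * h₂)))
        - h₀ / h₁ * ((b - a)⁻¹ * (v₂ * m₁ * (x₂ * y₁ - x₁ * y₂))) := by
  have hμa : μ - a ≠ 0 := sub_ne_zero.mpr hμ
  have hba : b - a ≠ 0 := sub_ne_zero.mpr hb
  have hXH : v₂ * m₁ * (x₂ * h₁ - x₁ * h₂)
      = m₁ * ((a - μ) * x₁ * h₁ - x₀ * h₁ + x₁ * h₀) := by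
    linear_combination m₁ * h₁ * hx - m₁ * x₁ * hh
  have hXY : v₂ * m₁ * (x₂ * y₁ - x₁ * y₂)
      = m₁ * ((a - b) * x₁ * y₁ - x₀ * y₁ + x₁ * y₀) := by
    linear_combination m₁ * y₁ * hx - m₁ * x₁ * hy
  rw [hXH, hXY, mul_right_comm (v₂ * h₂ * h₀ / h₁ ^ 2), darboux_wronskian h1 h2 hh hx hy]
  field_simp
  ring

/-- under the FDT data, if `ψ` is an eigenfunction of the Lax
pair of the original solution at a spectral parameter `λ ∉ {λ_1,…,λ_N, μ}`,
then `ψ[1] = ψ − (h/h⁺) ψ⁺` satisfies the time-evolution equation of the Lax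
pair of the transformed `(N+1)`-source system, where `λ_{N+1} = μ`. -/
theorem fdt_transformed_eigenfunction_time_evolution
    (N : ℕ) (v p : ℤ → ℝ → ℝ) (φp φm : ℕ → ℤ → ℝ → ℝ) (lam : ℕ → ℝ)
    (vt pt : ℤ → ℝ → ℝ) (φpt φmt : ℕ → ℤ → ℝ → ℝ)
    (hdist : ∀ i < N, ∀ j < N, i ≠ j → lam i ≠ lam j)
    (hvt : ∀ n t, HasDerivAt (fun s => v n s) (vt n t) t)
    (hpt : ∀ n t, HasDerivAt (fun s => p n s) (pt n t) t)
    (hφpt : ∀ j < N, ∀ n t, HasDerivAt (fun s => φp j n s) (φpt j n t) t)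
    (hφmt : ∀ j < N, ∀ n t, HasDerivAt (fun s => φm j n s) (φmt j n t) t)
    -- the TLSCS system with N sources
    (heq1 : ∀ n t, vt n t =
      v n t * (p (n - 1) t + ∑ j ∈ range N, φm j (n - 1) t * φp j (n - 1) t)
        - v n t * (p n t + ∑ j ∈ range N, φm j n t * φp j n t))
    (heq2 : ∀ n t, pt n t =
      v n t * (1 + ∑ j ∈ range N, φm j (n - 1) t * φp j n t)
        - v (n + 1) t * (1 + ∑ j ∈ range N, φm j n t * φp j (n + 1) t))
    (heq3 : ∀ j < N, ∀ n t,
      v (n + 1) t * φp j (n + 1) t + p n t * φp j n t + φp j (n - 1) t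
        = lam j * φp j n t)
    (heq4 : ∀ j < N, ∀ n t,
      v n t * φm j (n - 1) t + p n t * φm j n t + φm j (n + 1) t
        = lam j * φm j n t)
    -- eigenfunctions f, g of the Lax pair at λ = μ
    (μ : ℝ) (hμ : ∀ j < N, μ ≠ lam j)
    (f g : ℤ → ℝ → ℝ) (ft gt : ℤ → ℝ → ℝ)
    (hft : ∀ n t, HasDerivAt (fun s => f n s) (ft n t) t)
    (hgt : ∀ n t, HasDerivAt (fun s => g n s) (gt n t) t)
    (hfS : ∀ n t, v (n + 1) t * f (n + 1) t + p n t * f n t + f (n - 1) t = μ * f n t)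
    (hfT : ∀ n t, -(ft n t) = v (n + 1) t * f (n + 1) t
      + ∑ j ∈ range N, (μ - lam j)⁻¹ *
          (v (n + 1) t * φm j n t * (φp j (n + 1) t * f n t - φp j n t * f (n + 1) t)))
    (hgS : ∀ n t, v (n + 1) t * g (n + 1) t + p n t * g n t + g (n - 1) t = μ * g n t)
    (hgT : ∀ n t, -(gt n t) = v (n + 1) t * g (n + 1) t
      + ∑ j ∈ range N, (μ - lam j)⁻¹ *
          (v (n + 1) t * φm j n t * (φp j (n + 1) t * g n t - φp j n t * g (n + 1) t)))
    -- the combination h = f + α g, nonvanishing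
    (α αd : ℝ → ℝ) (hα : ∀ t, α t ≠ 0) (hαd : ∀ t, HasDerivAt α (αd t) t)
    (c d : ℝ → ℝ) (cd dd : ℝ → ℝ)
    (hc : ∀ t, HasDerivAt c (cd t) t) (hd : ∀ t, HasDerivAt d (dd t) t)
    (hcdval : ∀ t, c t * d t = -(αd t) / α t)
    (h : ℤ → ℝ → ℝ) (hdef : ∀ n t, h n t = f n t + α t * g n t)
    (hne : ∀ n t, h n t ≠ 0)
    -- the transformed quantities
    (V1 P1 : ℤ → ℝ → ℝ) (Φp Φm : ℕ → ℤ → ℝ → ℝ) (κ : ℕ → ℝ → ℝ)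
    (hV1 : ∀ n t, V1 n t = v (n + 1) t * h (n + 1) t * h (n - 1) t / (h n t) ^ 2)
    (hP1 : ∀ n t, P1 n t = p n t - h n t / h (n + 1) t + h (n - 1) t / h n t)
    (hκ : ∀ i < N, ∀ t, κ i t = (μ - lam i)⁻¹ *
      (v 1 t * h 1 t * φm i 0 t - h 0 t * φm i 1 t))
    (hΦp : ∀ i < N, ∀ n t, Φp i n t = φp i n t - h n t / h (n + 1) t * φp i (n + 1) t)
    (hΦm : ∀ i < N, ∀ n t, Φm i n t =
      (discSum (fun m => h (m + 1) t * φm i (m + 1) t) n + κ i t) / h n t)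
    (hΦpN : ∀ n t, Φp N n t = c t * (f n t - h n t / h (n + 1) t * f (n + 1) t))
    (hΦmN : ∀ n t, Φm N n t = d t / h n t)
    -- an eigenfunction ψ of the original Lax pair at λ ∉ {λ_1,…,λ_N, μ}
    (lamψ : ℝ) (hlamψ : ∀ j < N, lamψ ≠ lam j) (hlamψμ : lamψ ≠ μ)
    (ψ ψt : ℤ → ℝ → ℝ)
    (hψt : ∀ n t, HasDerivAt (fun s => ψ n s) (ψt n t) t)
    (hψS : ∀ n t, v (n + 1) t * ψ (n + 1) t + p n t * ψ n t + ψ (n - 1) t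
      = lamψ * ψ n t)
    (hψT : ∀ n t, -(ψt n t) = v (n + 1) t * ψ (n + 1) t
      + ∑ j ∈ range N, (lamψ - lam j)⁻¹ *
          (v (n + 1) t * φm j n t * (φp j (n + 1) t * ψ n t - φp j n t * ψ (n + 1) t)))
    (Ψ1 : ℤ → ℝ → ℝ)
    (hΨ1 : ∀ n t, Ψ1 n t = ψ n t - h n t / h (n + 1) t * ψ (n + 1) t) :
    ∀ n : ℤ, ∀ t : ℝ,
      -(deriv (fun s => Ψ1 n s) t)
        = V1 (n + 1) t * Ψ1 (n + 1) t
          + ∑ j ∈ range N, (lamψ - lam j)⁻¹ *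
              (V1 (n + 1) t * Φm j n t *
                (Φp j (n + 1) t * Ψ1 n t - Φp j n t * Ψ1 (n + 1) t))
          + (lamψ - μ)⁻¹ *
              (V1 (n + 1) t * Φm N n t *
                (Φp N (n + 1) t * Ψ1 n t - Φp N n t * Ψ1 (n + 1) t)) := by
  intro n t
  obtain ⟨A, hA⟩ : ∃ A : ℤ → ℝ, ∀ n, A n = ∑ j ∈ range N, (lamψ - lam j)⁻¹ *
      (v (n + 1) t * φm j n t * (φp j (n + 1) t * ψ n t - φp j n t * ψ (n + 1) t)) :=
    ⟨_, fun _ => rfl⟩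
  obtain ⟨B, hB⟩ : ∃ B : ℤ → ℝ, ∀ n, B n = ∑ j ∈ range N, (μ - lam j)⁻¹ *
      (v (n + 1) t * φm j n t * (φp j (n + 1) t * h n t - φp j n t * h (n + 1) t)) :=
    ⟨_, fun _ => rfl⟩
  have hhS : ∀ n, v (n + 1) t * h (n + 1) t + p n t * h n t + h (n - 1) t = μ * h n t := by
    intro n
    simp only [hdef]
    linear_combination hfS n t + α t * hgS n t
  have hht : ∀ n, HasDerivAt (fun s => h n s) (αd t * g n t - (v (n + 1) t * h (n + 1) t
      + B n)) t := by
    intro n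
    rw [hB]
    simp only [hdef]
    refine ((hft n t).add ((hαd t).mul (hgt n t))).congr_deriv ?_
    have hsum : ∑ j ∈ range N, (μ - lam j)⁻¹ * (v (n + 1) t * φm j n t *
          (φp j (n + 1) t * (f n t + α t * g n t)
            - φp j n t * (f (n + 1) t + α t * g (n + 1) t)))
        = ∑ j ∈ range N, (μ - lam j)⁻¹ * (v (n + 1) t * φm j n t *
            (φp j (n + 1) t * f n t - φp j n t * f (n + 1) t))
          + α t * ∑ j ∈ range N, (μ - lam j)⁻¹ * (v (n + 1) t * φm j n t *
            (φp j (n + 1) t * g n t - φp j n t * g (n + 1) t)) := by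
      rw [Finset.mul_sum, ← Finset.sum_add_distrib]
      exact Finset.sum_congr rfl fun j _ => by ring
    rw [hsum]
    linear_combination -(hfT n t) - α t * hgT n t
  have hΨt := ((hψt n t).sub (((hht n).div (hht (n + 1)) (hne (n + 1) t)).mul
    (hψt (n + 1) t))).deriv
  have hΨeq : (fun s => Ψ1 n s) = (fun s => ψ n s) -
      ((fun s => h n s) / fun s => h (n + 1) s) * fun s => ψ (n + 1) s := by
    ext s
    simp [hΨ1]
  have h0 := hne n t
  have h1 := hne (n + 1) t
  have h2 := hne (n + 1 + 1) t
  have hh := hhS (n + 1)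
  have hy := hψS (n + 1) t
  have hf := hfS (n + 1) t
  rw [add_sub_cancel_right] at hh hy hf
  have hsources : ∑ j ∈ range N, (lamψ - lam j)⁻¹ * (V1 (n + 1) t * Φm j n t *
        (Φp j (n + 1) t * Ψ1 n t - Φp j n t * Ψ1 (n + 1) t))
      = A n - ψ (n + 1) t / h (n + 1) t * B n
        + h n t * ψ (n + 1) t / h (n + 1) t ^ 2 * B (n + 1)
        - h n t / h (n + 1) t * A (n + 1) := by
    rw [hA, hA, hB, hB, Finset.mul_sum, Finset.mul_sum, Finset.mul_sum, ← Finset.sum_sub_distrib,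
      ← Finset.sum_add_distrib, ← Finset.sum_sub_distrib]
    refine Finset.sum_congr rfl fun j hj => ?_
    have hjN := Finset.mem_range.mp hj
    have hx := heq3 j hjN (n + 1) t
    rw [add_sub_cancel_right] at hx
    rw [hV1, hΦm j hjN, hκ j hjN, discSum_mul_add_eq (v := (v · t)) (p := (p · t))
      (h := (h · t)) (φ := (φm j · t)) (hμ j hjN) hhS (fun k => heq4 j hjN k t) n,
      hΦp j hjN, hΦp j hjN, hΨ1, hΨ1, add_sub_cancel_right]
    exact darboux_source_term h0 h1 h2 (hμ j hjN) (hlamψ j hjN) hh hx hy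
  have hnew : (lamψ - μ)⁻¹ * (V1 (n + 1) t * Φm N n t *
        (Φp N (n + 1) t * Ψ1 n t - Φp N n t * Ψ1 (n + 1) t))
      = αd t * ψ (n + 1) t * (g n t * h (n + 1) t - h n t * g (n + 1) t)
        / h (n + 1) t ^ 2 := by
    have hW := darboux_wronskian h1 h2 hh hf hy
    have hlμ : lamψ - μ ≠ 0 := sub_ne_zero.mpr hlamψμ
    have hfg : f n t * h (n + 1) t - h n t * f (n + 1) t
        = -(α t) * (g n t * h (n + 1) t - h n t * g (n + 1) t) := by
      rw [hdef, hdef]; ring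
    have hcd : c t * d t * α t = -(αd t) := by
      rw [hcdval, div_mul_cancel₀ _ (hα t)]
    rw [hfg] at hW
    rw [hV1, hΦmN, hΦpN, hΦpN, hΨ1, hΨ1, add_sub_cancel_right]
    calc _ = (lamψ - μ)⁻¹ * (c t * d t / h n t) * (h n t / h (n + 1) t ^ 2 *
          ((lamψ - μ) * ψ (n + 1) t *
            (-(α t) * (g n t * h (n + 1) t - h n t * g (n + 1) t)))) := by
          linear_combination ((lamψ - μ)⁻¹ * (c t * d t / h n t)) * hW
      _ = -(c t * d t * α t) * ψ (n + 1) t * (g n t * h (n + 1) t - h n t * g (n + 1) t)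
          / h (n + 1) t ^ 2 := by
          field_simp
      _ = _ := by rw [hcd, neg_neg]
  rw [hΨeq, hΨt, hsources, hnew, hV1, hΨ1, add_sub_cancel_right,
    ← neg_neg (ψt n t), ← neg_neg (ψt (n + 1) t), hψT, hψT, ← hA, ← hA]
  simp only [Pi.div_apply]
  field_simp
  ring
end

section
/- Let v, p : ℤ × ℝ → ℝ, let λ_i, μ ∈ ℝ with μ ≠ λ_i, let φ₋ : ℤ × ℝ → ℝ satisfy the adjoint spectral equation v φ₋⁻ + p φ₋ + φ₋⁺ = λ_i φ₋ at every (n,t), and let h : ℤ × ℝ → ℝ satisfy the spectral equation v⁺ h⁺ + p h + h⁻ = μ h at every (n,t). Define S(n,t) = Δ⁻¹E(h φ₋)(n,t) + κ(t) with κ(t) = (μ − λ_i)^{-1}·(v⁺ h⁺ φ₋ − h φ₋⁺)(0,t). Then (μ − λ_i)·S(n,t) = (v⁺ h⁺ φ₋ − h φ₋⁺)(n,t) for all (n,t) ∈ ℤ × ℝ. -/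
open Finset

/-- Telescoping for `discSum`: `Δ⁻¹` inverts the forward difference up to the value at `0`. -/
theorem mul_discSum_eq_sub {F G : ℤ → ℝ} {c : ℝ}
    (hG : ∀ m, G (m + 1) - G m = c * F m) (n : ℤ) :
    c * discSum F n = G n - G 0 := by
  have sum_eq (a : ℤ) (k : ℕ) :
      c * ∑ m ∈ Finset.range k, F (a + (m : ℤ)) = G (a + k) - G a := by
    induction k with
    | zero => simp
    | succ k ih =>
      rw [Finset.sum_range_succ, mul_add, ih, ← hG]
      push_cast
      rw [← add_assoc]
      ring
  unfold discSum
  split_ifs with hn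
  · simpa [Int.toNat_of_nonneg hn] using sum_eq 0 n.toNat
  · have := sum_eq n (-n).toNat
    rw [Int.toNat_of_nonneg (by lia), add_neg_cancel] at this
    linarith

/-- the discrete Wronskian-type identity
`(μ − λ_i)·S(n,t) = (v⁺ h⁺ φ₋ − h φ₋⁺)(n,t)` where
`S = Δ⁻¹E(h φ₋) + κ`, `κ(t) = (μ − λ_i)⁻¹(v⁺ h⁺ φ₋ − h φ₋⁺)(0,t)`,
for `φ₋` a solution of the adjoint spectral equation with eigenvalue `λ_i`
and `h` a solution of the spectral equation with eigenvalue `μ ≠ λ_i`. -/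
theorem fdt_adjoint_key_identity
    (v p φm h : ℤ → ℝ → ℝ) (lami μ : ℝ) (hμ : μ ≠ lami)
    (hφ : ∀ n : ℤ, ∀ t : ℝ,
      v n t * φm (n - 1) t + p n t * φm n t + φm (n + 1) t = lami * φm n t)
    (hh : ∀ n : ℤ, ∀ t : ℝ,
      v (n + 1) t * h (n + 1) t + p n t * h n t + h (n - 1) t = μ * h n t) :
    ∀ n : ℤ, ∀ t : ℝ,
      (μ - lami) *
        (discSum (fun m => h (m + 1) t * φm (m + 1) t) n
          + (μ - lami)⁻¹ * (v 1 t * h 1 t * φm 0 t - h 0 t * φm 1 t))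
      = v (n + 1) t * h (n + 1) t * φm n t - h n t * φm (n + 1) t := by
  intro n t
  have key := mul_discSum_eq_sub (c := μ - lami)
    (F := fun m => h (m + 1) t * φm (m + 1) t)
    (G := fun m => v (m + 1) t * h (m + 1) t * φm m t - h m t * φm (m + 1) t)
    (fun m => by
      have h₁ := hφ (m + 1) t
      have h₂ := hh (m + 1) t
      rw [add_sub_cancel_right] at h₁ h₂
      linear_combination φm (m + 1) t * h₂ - h (m + 1) t * h₁) n
  rw [mul_add, mul_inv_cancel_left₀ (sub_ne_zero.mpr hμ), key]
  simp
end

section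
/- Let v, p : ℤ × ℝ → ℝ, let μ_1,…,μ_l be pairwise distinct reals, let h_1,…,h_l : ℤ × ℝ → ℝ satisfy v⁺ h_j⁺ + p h_j + h_j⁻ = μ_j h_j with cas(h_1,…,h_l)(n,t) ≠ 0 for all (n,t), and let ψ : ℤ × ℝ → ℝ satisfy v⁺ ψ⁺ + p ψ + ψ⁻ = λ ψ for some λ ∈ ℝ. Then ψ[l] = cas(ψ,h_1,…,h_l)/(E cas(h_1,…,h_l)) satisfies the transformed spectral problem v[l]⁺ ψ[l]⁺ + p[l] ψ[l] + ψ[l]⁻ = λ ψ[l] at every (n,t), where v[l](n,t) = v(n+l,t)·cas(h)(n+1,t)·cas(h)(n−1,t)/cas(h)(n,t)² and p[l] = p + (E⁻¹ wcas(h))/cas(h) − wcas(h)/(E cas(h)). -/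
open Finset

/-- The Casorati determinant `cas(u_0,…,u_{l-1})(n,t) = det(u_i(n+k,t))_{i,k}`. -/
noncomputable def cas (l : ℕ) (u : ℕ → ℤ → ℝ → ℝ) (n : ℤ) (t : ℝ) : ℝ :=
  Matrix.det (Matrix.of fun i k : Fin l => u (i : ℕ) (n + ((k : ℕ) : ℤ)) t)

/-- The Casorati determinant `cas(ψ,u_0,…,u_{l-1})(n,t)` of `l+1` functions,
the first being `ψ`. -/
noncomputable def casCons (l : ℕ) (ψ : ℤ → ℝ → ℝ) (u : ℕ → ℤ → ℝ → ℝ)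
    (n : ℤ) (t : ℝ) : ℝ :=
  Matrix.det (Matrix.of fun i k : Fin (l + 1) =>
    (if (i : ℕ) = 0 then ψ else u ((i : ℕ) - 1)) (n + ((k : ℕ) : ℤ)) t)

/-- The modified Casorati determinant `wcas`, with shift indices
`k ∈ {0,2,3,…,l}`. -/
noncomputable def wcas (l : ℕ) (u : ℕ → ℤ → ℝ → ℝ) (n : ℤ) (t : ℝ) : ℝ :=
  Matrix.det (Matrix.of fun i k : Fin l =>
    u (i : ℕ) (n + (if (k : ℕ) = 0 then 0 else ((k : ℕ) : ℤ) + 1)) t)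

/-- The minor of the Casorati matrix of `u_0,…,u_{l-1}` with the shift `k` left out. -/
noncomputable def casMinor (l : ℕ) (u : ℕ → ℤ → ℝ → ℝ) (k : ℕ) (n : ℤ) (t : ℝ) : ℝ :=
  Matrix.det (Matrix.of fun i j : Fin l =>
    u (i : ℕ) (n + ((if (j : ℕ) < k then (j : ℕ) else (j : ℕ) + 1 : ℕ) : ℤ)) t)

theorem casMinor_zero (l : ℕ) (u : ℕ → ℤ → ℝ → ℝ) (n : ℤ) (t : ℝ) :
    casMinor l u 0 n t = cas l u (n + 1) t := by
  unfold casMinor cas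
  congr 1
  ext i j
  simp [add_assoc, add_comm (1 : ℤ)]

theorem casMinor_one (l : ℕ) (u : ℕ → ℤ → ℝ → ℝ) (n : ℤ) (t : ℝ) :
    casMinor l u 1 n t = wcas l u n t := by
  unfold casMinor wcas
  congr 1
  ext i j
  by_cases hj : (j : ℕ) = 0 <;> simp [hj]

theorem casMinor_self (l : ℕ) (u : ℕ → ℤ → ℝ → ℝ) (n : ℤ) (t : ℝ) :
    casMinor l u l n t = cas l u n t := by
  unfold casMinor cas
  congr 1
  ext i j
  simp

/-- Laplace expansion of `casCons` along its first row. -/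
theorem casCons_eq_sum (l : ℕ) (ψ : ℤ → ℝ → ℝ) (u : ℕ → ℤ → ℝ → ℝ) (n : ℤ) (t : ℝ) :
    casCons l ψ u n t =
      ∑ k ∈ range (l + 1), (-1) ^ k * casMinor l u k n t * ψ (n + (k : ℤ)) t := by
  unfold casCons
  rw [Matrix.det_succ_row_zero, ← Fin.sum_univ_eq_sum_range
    (fun k => (-1) ^ k * casMinor l u k n t * ψ (n + (k : ℤ)) t)]
  refine sum_congr rfl fun k _ => ?_
  have hminor : Matrix.det ((Matrix.of fun i k : Fin (l + 1) =>
      (if (i : ℕ) = 0 then ψ else u ((i : ℕ) - 1)) (n + ((k : ℕ) : ℤ)) t).submatrix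
        Fin.succ k.succAbove) = casMinor l u k n t := by
    unfold casMinor
    congr 1
    ext i j
    simp only [Matrix.submatrix_apply, Matrix.of_apply, Fin.val_succ, Nat.add_eq_zero_iff,
      one_ne_zero, and_false, if_false, Nat.add_sub_cancel]
    congr 3
    by_cases hjk : (j : ℕ) < k <;> simp [Fin.succAbove, Fin.lt_def, hjk]
  rw [hminor]
  simp only [Matrix.of_apply, Fin.val_zero, ↓reduceIte]
  ring

theorem casCons_self {l : ℕ} (u : ℕ → ℤ → ℝ → ℝ) {j : ℕ} (hj : j < l) (n : ℤ) (t : ℝ) :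
    casCons l (u j) u n t = 0 := by
  unfold casCons
  refine Matrix.det_zero_of_row_eq (i := 0) (j := Fin.succ ⟨j, hj⟩) (Fin.succ_ne_zero _).symm ?_
  ext k
  simp

theorem eq_zero_of_sum_mul_eq_zero {l : ℕ} {u : ℕ → ℤ → ℝ → ℝ} {n : ℤ} {t : ℝ}
    (hu : cas l u n t ≠ 0) {r : ℕ → ℝ}
    (hr : ∀ j < l, ∑ k ∈ range l, r k * u j (n + (k : ℤ)) t = 0) : ∀ k < l, r k = 0 := by
  have hzero : (fun k : Fin l => r k) = 0 := by
    refine Matrix.eq_zero_of_mulVec_eq_zero hu ?_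
    ext i
    have hi := hr i i.2
    rw [← Fin.sum_univ_eq_sum_range (fun k => r k * u i (n + (k : ℤ)) t)] at hi
    simpa [Matrix.mulVec, dotProduct, mul_comm] using hi
  exact fun k hk => congrFun hzero ⟨k, hk⟩

/-- If the coefficients of `E⁻¹`, `E⁰` and `E^(m+2)` in `L'D - DL` vanish, where
`L = a E + b + E⁻¹`, `L' = A E + B + E⁻¹` and `D = ∑ d_k E^k` has order `m + 1`, then `L'D - DL`
only involves `E, …, E^(m+1)`. -/
theorem exists_intertwining_remainder (m : ℕ) (d : ℕ → ℤ → ℝ) (a b : ℤ → ℝ) (A B : ℝ) (n : ℤ)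
    (hd : ∀ i, d (m + 2) i = 0) (hd₀ : ∀ i, d 0 i = 1)
    (hA : A * d (m + 1) (n + 1) = d (m + 1) n * a (n + (m + 1 : ℕ)))
    (hB : B + d 1 (n - 1) = b n + d 1 n) :
    ∃ r : ℕ → ℝ, ∀ f : ℤ → ℝ,
      A * ∑ k ∈ range (m + 2), d k (n + 1) * f (n + 1 + k)
        + B * ∑ k ∈ range (m + 2), d k n * f (n + k)
        + ∑ k ∈ range (m + 2), d k (n - 1) * f (n - 1 + k)
        = ∑ k ∈ range (m + 2), d k n *
            (a (n + k) * f (n + k + 1) + b (n + k) * f (n + k) + f (n + k - 1))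
          + ∑ k ∈ range (m + 1), r k * f (n + 1 + k) := by
  refine ⟨fun k => A * d k (n + 1) + B * d (k + 1) n + d (k + 2) (n - 1)
    - d k n * a (n + k) - d (k + 1) n * b (n + 1 + k) - d (k + 2) n, fun f => ?_⟩
  have hback (c : ℕ → ℝ) (hc : c (m + 2) = 0) :
      ∑ k ∈ range (m + 2), c k * f (n - 1 + k) = c 0 * f (n - 1) + c 1 * f n
        + ∑ k ∈ range (m + 1), c (k + 2) * f (n + 1 + k) := by
    have hext : ∑ k ∈ range (m + 2), c k * f (n - 1 + k)
        = ∑ k ∈ range (m + 1 + 1 + 1), c k * f (n - 1 + k) := by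
      rw [sum_range_succ _ (m + 1 + 1), hc]; ring
    rw [hext, sum_range_succ', sum_range_succ']
    have hsum : ∑ k ∈ range (m + 1), c (k + 1 + 1) * f (n - 1 + ((k + 1 + 1 : ℕ) : ℤ))
        = ∑ k ∈ range (m + 1), c (k + 2) * f (n + 1 + k) :=
      sum_congr rfl fun k _ => by congr 2; push_cast; ring
    rw [hsum]
    simp only [zero_add, Nat.cast_one, Nat.cast_zero, add_zero, sub_add_cancel]
    ring
  have hmid (c : ℕ → ℝ) : ∑ k ∈ range (m + 2), c k * f (n + k) = c 0 * f n
        + ∑ k ∈ range (m + 1), c (k + 1) * f (n + 1 + k) := by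
    rw [sum_range_succ']
    have hsum : ∑ k ∈ range (m + 1), c (k + 1) * f (n + ((k + 1 : ℕ) : ℤ))
        = ∑ k ∈ range (m + 1), c (k + 1) * f (n + 1 + k) :=
      sum_congr rfl fun k _ => by congr 2; push_cast; ring
    rw [hsum]
    simp only [Nat.cast_zero, add_zero]
    ring
  have hsplit : ∑ k ∈ range (m + 2), d k n *
        (a (n + k) * f (n + k + 1) + b (n + k) * f (n + k) + f (n + k - 1))
      = ∑ k ∈ range (m + 2), d k n * a (n + k) * f (n + 1 + k)
        + ∑ k ∈ range (m + 2), d k n * b (n + k) * f (n + k)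
        + ∑ k ∈ range (m + 2), d k n * f (n - 1 + k) := by
    simp only [← sum_add_distrib]
    refine sum_congr rfl fun k _ => ?_
    rw [show n + (k : ℤ) + 1 = n + 1 + k by ring, show n + (k : ℤ) - 1 = n - 1 + k by ring]
    ring
  rw [hsplit, hback _ (hd _), hback _ (hd _), hmid, hmid (fun k => d k n * b (n + k)),
    sum_range_succ _ (m + 1), sum_range_succ _ (m + 1)]
  have hshift : ∀ k : ℕ, n + ((k + 1 : ℕ) : ℤ) = n + 1 + k := fun k => by push_cast; ring
  simp only [hd₀, hshift, Nat.cast_zero, add_zero, sub_mul, add_mul, sum_add_distrib,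
    sum_sub_distrib, mul_add, mul_sum, mul_assoc] at *
  linear_combination f (n + 1 + ((m + 1 : ℕ) : ℤ)) * hA + f n * hB

/-- spectral part of the `l`-times repeated forward Darboux
transformation. If `h_1,…,h_l` solve the spectral problem with pairwise distinct
eigenvalues `μ_j` and nonvanishing Casoratian, and `ψ` solves it with eigenvalue
`λ`, then `ψ[l] = cas(ψ,h)/(E cas(h))` solves the transformed spectral problem
with `v[l](n) = v(n+l)·cas(h)(n+1)·cas(h)(n−1)/cas(h)(n)²` and
`p[l] = p + (E⁻¹ wcas(h))/cas(h) − wcas(h)/(E cas(h))`. -/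
theorem repeated_fdt_spectral
    (l : ℕ) (v p ψ : ℤ → ℝ → ℝ) (h : ℕ → ℤ → ℝ → ℝ) (μ : ℕ → ℝ) (lam : ℝ)
    (hdist : ∀ i < l, ∀ j < l, i ≠ j → μ i ≠ μ j)
    (hspec : ∀ j < l, ∀ n : ℤ, ∀ t : ℝ,
      v (n + 1) t * h j (n + 1) t + p n t * h j n t + h j (n - 1) t = μ j * h j n t)
    (hcas : ∀ n : ℤ, ∀ t : ℝ, cas l h n t ≠ 0)
    (hψ : ∀ n : ℤ, ∀ t : ℝ,
      v (n + 1) t * ψ (n + 1) t + p n t * ψ n t + ψ (n - 1) t = lam * ψ n t)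
    (Vl Pl Ψl : ℤ → ℝ → ℝ)
    (hVl : ∀ n t, Vl n t =
      v (n + (l : ℤ)) t * cas l h (n + 1) t * cas l h (n - 1) t / (cas l h n t) ^ 2)
    (hPl : ∀ n t, Pl n t =
      p n t + wcas l h (n - 1) t / cas l h n t - wcas l h n t / cas l h (n + 1) t)
    (hΨl : ∀ n t, Ψl n t = casCons l ψ h n t / cas l h (n + 1) t) :
    ∀ n : ℤ, ∀ t : ℝ,
      Vl (n + 1) t * Ψl (n + 1) t + Pl n t * Ψl n t + Ψl (n - 1) t
        = lam * Ψl n t := by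
  rcases l with _ | m
  · intro n t
    have hV := hVl (n + 1) t
    have hP := hPl n t
    simp only [hΨl]
    simp [cas, casCons, wcas] at hV hP ⊢
    rw [hV, hP]
    exact hψ n t
  intro n t
  set d : ℕ → ℤ → ℝ := fun k i =>
    if k ≤ m + 1 then (-1) ^ k * casMinor (m + 1) h k i t / cas (m + 1) h (i + 1) t else 0
    with hd
  have hD (f : ℤ → ℝ → ℝ) (i : ℤ) :
      ∑ k ∈ range (m + 2), d k i * f (i + k) t
        = casCons (m + 1) f h i t / cas (m + 1) h (i + 1) t := by
    rw [casCons_eq_sum, sum_div]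
    refine sum_congr rfl fun k hk => ?_
    have hk' : k ≤ m + 1 := by simpa [Nat.lt_succ_iff] using hk
    simp only [hd, if_pos hk']
    ring
  have hDL (f : ℤ → ℝ → ℝ) (c : ℝ)
      (hf : ∀ i, v (i + 1) t * f (i + 1) t + p i t * f i t + f (i - 1) t = c * f i t) :
      ∑ k ∈ range (m + 2), d k n * (v (n + k + 1) t * f (n + k + 1) t
        + p (n + k) t * f (n + k) t + f (n + k - 1) t)
        = c * (casCons (m + 1) f h n t / cas (m + 1) h (n + 1) t) := by
    rw [← hD, mul_sum]
    refine sum_congr rfl fun k _ => ?_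
    rw [hf]
    ring
  obtain ⟨r, hr⟩ := exists_intertwining_remainder m d (fun i => v (i + 1) t) (fun i => p i t)
    (Vl (n + 1) t) (Pl n t) n (fun i => by simp [hd])
    (fun i => by simp [hd, casMinor_zero, div_self (hcas (i + 1) t)])
    (by
      have h₁ := hcas (n + 1) t
      have h₂ := hcas (n + 1 + 1) t
      simp only [hd, le_refl, if_true, casMinor_self, hVl, add_sub_cancel_right]
      rw [show n + 1 + ((m + 1 : ℕ) : ℤ) = n + ((m + 1 : ℕ) : ℤ) + 1 by ring]
      field_simp)
    (by
      simp only [hd, Nat.le_add_left, if_true, casMinor_one, hPl, sub_add_cancel]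
      ring)
  have hr₀ : ∀ k < m + 1, r k = 0 := by
    refine eq_zero_of_sum_mul_eq_zero (hcas (n + 1) t) fun j hj => ?_
    have hrj := hr fun i => h j i t
    rw [hD, hD, hD, hDL (h j) (μ j) fun i => hspec j hj i t] at hrj
    simpa [casCons_self h hj] using hrj.symm
  have hrψ := hr fun i => ψ i t
  rw [hD, hD, hD, hDL ψ lam fun i => hψ i t,
    sum_eq_zero fun k hk => by rw [hr₀ k (mem_range.1 hk), zero_mul], add_zero] at hrψ
  simpa only [hΨl] using hrψ
end

section
/- Let m ≥ 2, let u, v : ℂ → ℂ^m be analytic in a neighborhood of ω ∈ ℂ, let e_1,…,e_m be pairwise distinct complex numbers, let b_1,…,b_m ∈ ℂ with Σ_{s=1}^m b_s = β, set p_s = (1/(m−1)!)·∏_{i≠s}(e_i − e_s) and ρ_s(ε) = exp(ε^{m−1} p_s b_s). Let M(ε) be the m×m matrix whose s-th column is u(ω + ε e_s) + ρ_s(ε)·v(ω + ε e_s). Then, as ε → 0, det M(ε) = (ε^{m(m−1)/2}/(1!·2!·⋯·(m−1)!))·∏_{1≤i<j≤m}(e_j − e_i)·det(w(ω), w'(ω),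 …, w^{(m−2)}(ω), w^{(m−1)}(ω) + (−1)^{m−1} β v(ω)) + o(ε^{m(m−1)/2}), where w = u + v and derivatives are taken in the variable ω. -/
open Finset Filter Asymptotics
open scoped Topology

/-- Taylor expansion of a vector-valued analytic function with little-o remainder. -/
theorem AnalyticAt.sub_sum_iteratedDeriv_isLittleO {E : Type*} [NormedAddCommGroup E]
    [NormedSpace ℂ E] [CompleteSpace E] {f : ℂ → E} {x : ℂ} (hf : AnalyticAt ℂ f x) (n : ℕ) :
    (fun y : ℂ => f (x + y) -
        ∑ k ∈ range (n + 1), (y ^ k / (Nat.factorial k : ℂ)) • iteratedDeriv k f x)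
      =o[𝓝 0] fun y => y ^ n := by
  obtain ⟨p, r, hp⟩ := hf
  have h := HasFPowerSeriesAt.isBigO_sub_partialSum_pow ⟨r, hp⟩ (n + 1)
  have hO : (fun y : ℂ => f (x + y) - p.partialSum (n + 1) y) =O[𝓝 0] fun y => y ^ (n + 1) := by
    refine h.trans (IsBigO.of_norm_right ?_)
    simpa only [norm_pow] using isBigO_refl _ _
  refine (hO.trans_isLittleO (isLittleO_pow_pow n.lt_succ_self)).congr_left fun y => ?_
  congr 1
  refine Finset.sum_congr rfl fun k _ => ?_
  have hk := hp.factorial_smul y k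
  have hc : (fun _ : Fin k => y) = fun i : Fin k => (fun _ => y) i • (fun _ => (1 : ℂ)) i := by
    simp
  have h0 : (Nat.factorial k : ℂ) ≠ 0 := by exact_mod_cast k.factorial_ne_zero
  have hd : iteratedFDeriv ℂ k f x (fun _ => y) = y ^ k • iteratedDeriv k f x := by
    rw [iteratedDeriv_eq_iteratedFDeriv, hc, ContinuousMultilinearMap.map_smul_univ]
    simp
  rw [hd, ← Nat.cast_smul_eq_nsmul ℂ] at hk
  rw [div_eq_inv_mul, mul_smul, ← hk, inv_smul_smul₀ h0]

/-- The last column of `G * V⁻¹`, with `V` the transposed Vandermonde matrix, is a divided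
difference. -/
theorem apply_last_eq_sum_div_of_mul_vandermonde_transpose {n : ℕ} {x : Fin (n + 1) → ℂ}
    (hx : Function.Injective x) {A G : Matrix (Fin (n + 1)) (Fin (n + 1)) ℂ}
    (h : A * (Matrix.vandermonde x).transpose = G) (i : Fin (n + 1)) :
    A i (Fin.last n) = ∑ s, G i s / ∏ j ∈ univ.erase s, (x s - x j) := by
  let P : Polynomial ℂ := ∑ k : Fin (n + 1), Polynomial.monomial (k : ℕ) (A i k)
  have hdeg : P.degree < #(univ : Finset (Fin (n + 1))) := by
    refine (Polynomial.degree_sum_le _ _).trans_lt ?_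
    rw [Finset.sup_lt_iff (by simp)]
    intro k _
    refine (Polynomial.degree_monomial_le _ _).trans_lt ?_
    simp only [card_univ, Fintype.card_fin]
    exact_mod_cast k.2
  have hP := Lagrange.coeff_eq_sum (v := x) hx.injOn hdeg
  have hcoeff : P.coeff n = A i (Fin.last n) := by
    simp only [P, Polynomial.finsetSum_coeff, Polynomial.coeff_monomial]
    rw [Finset.sum_eq_single (Fin.last n)]
    · simp
    · intro k _ hk
      exact if_neg fun h => hk (Fin.ext h)
    · simp
  have heval : ∀ s, P.eval (x s) = G i s := fun s => by
    simp [P, ← h, Matrix.mul_apply, Polynomial.eval_finsetSum, Matrix.vandermonde_apply]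
  simpa [hcoeff, heval] using hP

/-- Determinant of a matrix whose columns are polynomial curves sampled at the scaled nodes
`ε * x s`, perturbed at order `ε ^ n`. -/
theorem det_sub_pow_mul_det_isLittleO {n : ℕ} {x : Fin (n + 1) → ℂ}
    (hx : Function.Injective x) (A G : Matrix (Fin (n + 1)) (Fin (n + 1)) ℂ)
    (F : ℂ → Matrix (Fin (n + 1)) (Fin (n + 1)) ℂ)
    (hF : ∀ i s, (fun ε : ℂ => F ε i s -
        (∑ k : Fin (n + 1), (ε * x s) ^ (k : ℕ) * A i k + ε ^ n * G i s))
      =o[𝓝 0] fun ε : ℂ => ε ^ n) :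
    (fun ε : ℂ => (F ε).det - ε ^ (n * (n + 1) / 2) * (Matrix.vandermonde x).det *
        (Matrix.of fun i k => A i k + if k = Fin.last n then
          ∑ s, G i s / ∏ j ∈ univ.erase s, (x s - x j) else 0).det)
      =o[𝓝 0] fun ε : ℂ => ε ^ (n * (n + 1) / 2) := by
  choose R hR hFR using fun i s => (hF i s).exists_eq_mul
  set V := (Matrix.vandermonde x).transpose with hV
  have hVdet : IsUnit V.det := by
    rw [hV, Matrix.det_transpose]
    exact (Matrix.det_vandermonde_ne_zero_iff.2 hx).isUnit
  let N : ℂ → Matrix (Fin (n + 1)) (Fin (n + 1)) ℂ := fun ε =>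
    A + (G + Matrix.of fun i s => R i s ε) * V⁻¹ *
      Matrix.diagonal fun k : Fin (n + 1) => ε ^ (n - (k : ℕ))
  let N₀ : Matrix (Fin (n + 1)) (Fin (n + 1)) ℂ := Matrix.of fun i k => A i k +
    if k = Fin.last n then ∑ s, G i s / ∏ j ∈ univ.erase s, (x s - x j) else 0
  have hN : Tendsto N (𝓝 0) (𝓝 N₀) := by
    have hlim : A + (G + 0) * V⁻¹ *
        (Matrix.diagonal fun k : Fin (n + 1) => (0 : ℂ) ^ (n - (k : ℕ))) = N₀ := by
      ext i k
      simp only [N₀, add_zero, Matrix.add_apply, Matrix.mul_diagonal, Matrix.of_apply]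
      congr 1
      split_ifs with hk
      · subst hk
        rw [← apply_last_eq_sum_div_of_mul_vandermonde_transpose hx
          (Matrix.nonsing_inv_mul_cancel_right V G hVdet) i]
        simp
      · have : n - (k : ℕ) ≠ 0 := by
          have := k.2
          have : (k : ℕ) ≠ n := fun h => hk (Fin.ext h)
          lia
        simp [this]
    rw [← hlim]
    have hR' : Tendsto (fun ε => Matrix.of fun i s => R i s ε) (𝓝 0)
        (𝓝 (0 : Matrix (Fin (n + 1)) (Fin (n + 1)) ℂ)) :=
      tendsto_pi_nhds.2 fun i => tendsto_pi_nhds.2 fun s => hR i s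
    have hD : Tendsto (fun ε : ℂ => Matrix.diagonal fun k : Fin (n + 1) => ε ^ (n - (k : ℕ)))
        (𝓝 0) (𝓝 (Matrix.diagonal fun k : Fin (n + 1) => (0 : ℂ) ^ (n - (k : ℕ)))) :=
      Continuous.tendsto (by fun_prop) 0
    exact tendsto_const_nhds.add (((tendsto_const_nhds.add hR').mul tendsto_const_nhds).mul hD)
  have hfac : ∀ᶠ ε in 𝓝 (0 : ℂ), F ε = N ε *
      (Matrix.diagonal fun k : Fin (n + 1) => ε ^ (k : ℕ)) * V := by
    filter_upwards [eventually_all.2 fun i => eventually_all.2 fun s => hFR i s] with ε hε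
    have hdiag : (Matrix.diagonal fun k : Fin (n + 1) => ε ^ (n - (k : ℕ))) *
        (Matrix.diagonal fun k : Fin (n + 1) => ε ^ (k : ℕ)) = ε ^ n • 1 := by
      rw [Matrix.diagonal_mul_diagonal, Matrix.smul_one_eq_diagonal]
      congr 1
      ext k
      rw [← pow_add, Nat.sub_add_cancel (Nat.lt_succ_iff.1 k.2)]
    have hsplit : N ε * (Matrix.diagonal fun k : Fin (n + 1) => ε ^ (k : ℕ)) * V =
        A * (Matrix.diagonal fun k : Fin (n + 1) => ε ^ (k : ℕ)) * V +
          ε ^ n • (G + Matrix.of fun i s => R i s ε) := by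
      simp only [N]
      rw [Matrix.add_mul A, Matrix.add_mul (A * _), Matrix.mul_assoc _ (Matrix.diagonal _) (Matrix.diagonal _), hdiag, Matrix.mul_smul,
        Matrix.mul_one, Matrix.smul_mul, Matrix.nonsing_inv_mul_cancel_right _ _ hVdet]
    rw [hsplit]
    ext i s
    have h := hε i s
    simp only [Pi.mul_apply] at h
    rw [sub_eq_iff_eq_add] at h
    rw [h, Matrix.add_apply, Matrix.mul_apply]
    simp only [Matrix.add_apply, Matrix.smul_apply, Matrix.of_apply, smul_eq_mul, Matrix.mul_diagonal, hV, Matrix.transpose_apply,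
      Matrix.vandermonde_apply]
    have : ∑ k : Fin (n + 1), (ε * x s) ^ (k : ℕ) * A i k =
        ∑ k : Fin (n + 1), A i k * ε ^ (k : ℕ) * x s ^ (k : ℕ) :=
      Finset.sum_congr rfl fun k _ => by ring
    rw [this]
    ring
  have hdet : Tendsto (fun ε => (Matrix.vandermonde x).det * ((N ε).det - N₀.det))
      (𝓝 0) (𝓝 0) := by
    have hc : Tendsto (fun ε => (N ε).det) (𝓝 0) (𝓝 N₀.det) :=
      ((continuous_id.matrix_det).tendsto N₀).comp hN
    simpa using (hc.sub_const N₀.det).const_mul (Matrix.vandermonde x).det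
  refine isLittleO_iff_exists_eq_mul.2 ⟨_, hdet, ?_⟩
  filter_upwards [hfac] with ε hε
  have hpow : ∏ k : Fin (n + 1), ε ^ (k : ℕ) = ε ^ (n * (n + 1) / 2) := by
    rw [Finset.prod_pow_eq_pow_sum, Fin.sum_univ_eq_sum_range (fun k => k) (n + 1),
      Finset.sum_range_id, Nat.add_sub_cancel, mul_comm]
  rw [hε, Matrix.det_mul, Matrix.det_mul, Matrix.det_diagonal, hpow, hV, Matrix.det_transpose]
  simp only [Pi.mul_apply, N₀]
  ring

/-- First-order expansion of `exp (z ^ n * a)` times a continuous function. -/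
theorem exp_sub_one_mul_sub_isLittleO {n : ℕ} (hn : n ≠ 0) (a : ℂ) {g : ℂ → ℂ}
    (hg : ContinuousAt g 0) :
    (fun ε : ℂ => (Complex.exp (ε ^ n * a) - 1) * g ε - ε ^ n * (a * g 0))
      =o[𝓝 0] fun ε : ℂ => ε ^ n := by
  have hz : Tendsto (fun ε : ℂ => ε ^ n * a) (𝓝 0) (𝓝 0) := by
    have : Continuous fun ε : ℂ => ε ^ n * a := by fun_prop
    simpa [hn] using this.tendsto 0
  have hexp : (fun ε : ℂ => Complex.exp (ε ^ n * a) - 1 - ε ^ n * a) =o[𝓝 0]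
      fun ε : ℂ => ε ^ n := by
    have h := (Complex.exp_sub_sum_range_succ_isLittleO_pow 1).comp_tendsto hz
    have h' : (fun ε : ℂ => Complex.exp (ε ^ n * a) - 1 - ε ^ n * a) =o[𝓝 0]
        fun ε : ℂ => ε ^ n * a := by
      simpa [Function.comp_def, Finset.sum_range_succ, sub_sub] using h
    refine h'.trans_isBigO ?_
    simpa using (isBigO_refl (fun ε : ℂ => ε ^ n) (𝓝 0)).mul
      (isBigO_const_const a (one_ne_zero (α := ℂ)) (𝓝 0))
  have h1 : (fun ε : ℂ => (Complex.exp (ε ^ n * a) - 1 - ε ^ n * a) * g ε) =o[𝓝 0]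
      fun ε : ℂ => ε ^ n := by
    simpa using hexp.mul_isBigO (hg.tendsto.isBigO_one ℂ)
  have h2 : (fun ε : ℂ => ε ^ n * (a * (g ε - g 0))) =o[𝓝 0] fun ε : ℂ => ε ^ n := by
    have : Tendsto (fun ε => a * (g ε - g 0)) (𝓝 0) (𝓝 0) := by
      simpa using (hg.tendsto.sub_const (g 0)).const_mul a
    simpa using (isBigO_refl (fun ε : ℂ => ε ^ n) (𝓝 0)).mul_isLittleO
      ((isLittleO_one_iff ℂ).2 this)
  refine (h1.add h2).congr_left fun ε => ?_
  ring

/-- the determinant expansion which is the key lemma of the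
generalized forward Darboux transformation. With `ρ_s(ε) = exp(ε^{m−1} p_s b_s)`,
`p_s = (1/(m−1)!) ∏_{i≠s}(e_i − e_s)`, `Σ b_s = β`, and `M(ε)` the matrix with
columns `u(ω + ε e_s) + ρ_s(ε) v(ω + ε e_s)`, as `ε → 0`:
`det M(ε) = (ε^{m(m−1)/2}/(1!⋯(m−1)!)) ∏_{i<j}(e_j − e_i) ·
det(w, w', …, w^{(m−2)}, w^{(m−1)} + (−1)^{m−1} β v(ω)) + o(ε^{m(m−1)/2})`,
where `w = u + v`. -/
theorem det_expansion_full
    (m : ℕ) (hm : 2 ≤ m) (ω β : ℂ)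
    (u v : ℂ → Fin m → ℂ)
    (hu : AnalyticAt ℂ u ω) (hv : AnalyticAt ℂ v ω)
    (e b : ℕ → ℂ)
    (he : ∀ i < m, ∀ j < m, i ≠ j → e i ≠ e j)
    (hb : ∑ s ∈ range m, b s = β) :
    (fun ε : ℂ =>
        Matrix.det (Matrix.of fun (i s : Fin m) =>
          u (ω + ε * e (s : ℕ)) i
            + Complex.exp (ε ^ (m - 1) *
                (((Nat.factorial (m - 1) : ℂ))⁻¹ *
                  ∏ k ∈ (Finset.range m).erase (s : ℕ), (e k - e (s : ℕ))) *
                b (s : ℕ)) *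
              v (ω + ε * e (s : ℕ)) i)
      - ε ^ (m * (m - 1) / 2) / (∏ k ∈ range m, (Nat.factorial k : ℂ)) *
          (∏ i ∈ range m, ∏ j ∈ Finset.Ioo i m, (e j - e i)) *
          Matrix.det (Matrix.of fun (i k : Fin m) =>
            if (k : ℕ) = m - 1 then
              iteratedDeriv (m - 1) (fun z => u z + v z) ω i
                + (-1 : ℂ) ^ (m - 1) * β * v ω i
            else iteratedDeriv (k : ℕ) (fun z => u z + v z) ω i))
      =o[𝓝 (0 : ℂ)] fun ε : ℂ => ε ^ (m * (m - 1) / 2) := by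
  obtain ⟨n, rfl⟩ : ∃ n, m = n + 1 := ⟨m - 1, by lia⟩
  have hn : n ≠ 0 := by lia
  let x : Fin (n + 1) → ℂ := fun s => e s
  have hx : Function.Injective x := fun i j hij => by
    by_contra h
    exact he i i.2 j j.2 (fun h' => h (Fin.ext h')) hij
  set w : ℂ → Fin (n + 1) → ℂ := fun z => u z + v z with hw
  have hwa : AnalyticAt ℂ w ω := hu.add hv
  let q : Fin (n + 1) → ℂ := fun s => ((Nat.factorial n : ℂ))⁻¹ *
    (∏ k ∈ univ.erase s, (x k - x s)) * b s
  have hq : ∀ (ε : ℂ) (s : Fin (n + 1)), ε ^ n * (((Nat.factorial n : ℂ))⁻¹ *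
      ∏ k ∈ (range (n + 1)).erase (s : ℕ), (e k - e (s : ℕ))) * b s = ε ^ n * q s := by
    intro ε s
    simp only [q, x]
    rw [← mul_assoc (ε ^ n) (_ * _)]
    congr 3
    have : (range (n + 1)).erase (s : ℕ) =
        (univ.erase s).map Fin.valEmbedding := by
      rw [Finset.map_erase, Fin.map_valEmbedding_univ, Nat.Iio_eq_range]
      rfl
    rw [this, Finset.prod_map]
    rfl
  let A : Matrix (Fin (n + 1)) (Fin (n + 1)) ℂ := Matrix.of fun i k =>
    (Nat.factorial (k : ℕ) : ℂ)⁻¹ * iteratedDeriv (k : ℕ) w ω i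
  let G : Matrix (Fin (n + 1)) (Fin (n + 1)) ℂ := Matrix.of fun i s => q s * v ω i
  let F : ℂ → Matrix (Fin (n + 1)) (Fin (n + 1)) ℂ := fun ε => Matrix.of fun i s =>
    u (ω + ε * x s) i + Complex.exp (ε ^ n * q s) * v (ω + ε * x s) i
  have hF : ∀ i s, (fun ε : ℂ => F ε i s -
        (∑ k : Fin (n + 1), (ε * x s) ^ (k : ℕ) * A i k + ε ^ n * G i s))
      =o[𝓝 0] fun ε : ℂ => ε ^ n := by
    intro i s
    have hlin : Tendsto (fun ε : ℂ => ε * x s) (𝓝 0) (𝓝 0) := by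
      have : Continuous fun ε : ℂ => ε * x s := by fun_prop
      simpa using this.tendsto 0
    have h1 : (fun ε : ℂ => w (ω + ε * x s) i -
        ∑ k : Fin (n + 1), (ε * x s) ^ (k : ℕ) * A i k) =o[𝓝 0] fun ε : ℂ => ε ^ n := by
      have h := (isLittleO_pi.1 (hwa.sub_sum_iteratedDeriv_isLittleO n) i).comp_tendsto hlin
      have hO : ((fun y : ℂ => y ^ n) ∘ fun ε : ℂ => ε * x s) =O[𝓝 0] fun ε : ℂ => ε ^ n := by
        simp only [Function.comp_def, mul_pow]
        simpa using (isBigO_refl (fun ε : ℂ => ε ^ n) (𝓝 0)).mul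
          (isBigO_const_const (x s ^ n) (one_ne_zero (α := ℂ)) (𝓝 0))
      refine (h.trans_isBigO hO).congr_left fun ε => ?_
      simp only [Function.comp_apply, Pi.sub_apply, Finset.sum_apply, Pi.smul_apply, smul_eq_mul]
      rw [← Fin.sum_univ_eq_sum_range (fun k => (ε * x s) ^ k / (Nat.factorial k : ℂ) *
        iteratedDeriv k w ω i) (n + 1)]
      simp only [A, Matrix.of_apply, div_eq_mul_inv, mul_assoc]
    have hg : ContinuousAt (fun ε : ℂ => v (ω + ε * x s) i) 0 := by
      have hvc : ContinuousAt v (ω + 0 * x s) := by simpa using hv.continuousAt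
      have hin : ContinuousAt (fun ε : ℂ => ω + ε * x s) 0 := by fun_prop
      exact (continuous_apply i).continuousAt.comp
        (ContinuousAt.comp (f := fun ε : ℂ => ω + ε * x s) hvc hin)
    refine (h1.add (exp_sub_one_mul_sub_isLittleO hn (q s) hg)).congr_left fun ε => ?_
    simp only [F, G, hw, Matrix.of_apply, Pi.add_apply, zero_mul, add_zero]
    ring
  have key := det_sub_pow_mul_det_isLittleO hx A G F hF
  have hdd : ∀ i, ∑ s, G i s / ∏ j ∈ univ.erase s, (x s - x j) =
      (Nat.factorial n : ℂ)⁻¹ * ((-1) ^ n * β * v ω i) := by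
    intro i
    rw [← hb, ← Fin.sum_univ_eq_sum_range (fun s => b s) (n + 1), Finset.mul_sum,
      Finset.sum_mul, Finset.mul_sum]
    refine Finset.sum_congr rfl fun s _ => ?_
    have hp : ∏ k ∈ univ.erase s, (x k - x s) =
        (-1) ^ n * ∏ k ∈ univ.erase s, (x s - x k) := by
      simp only [← neg_sub (x s), Finset.prod_neg]
      simp [Finset.card_erase_of_mem]
    have h0 : ∏ k ∈ univ.erase s, (x s - x k) ≠ 0 := by
      refine Finset.prod_ne_zero_iff.2 fun k hk => sub_ne_zero.2 fun h => ?_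
      exact (Finset.mem_erase.1 hk).1 (hx h).symm
    simp only [G, q, Matrix.of_apply, hp]
    field_simp
  have hdet : (Matrix.of fun i k => A i k + if k = Fin.last n then
        ∑ s, G i s / ∏ j ∈ univ.erase s, (x s - x j) else 0).det =
      (∏ k ∈ range (n + 1), (Nat.factorial k : ℂ))⁻¹ *
        (Matrix.of fun (i k : Fin (n + 1)) => if (k : ℕ) = n then
          iteratedDeriv n w ω i + (-1 : ℂ) ^ n * β * v ω i
        else iteratedDeriv (k : ℕ) w ω i).det := by
    rw [← Fin.prod_univ_eq_prod_range (fun k => (Nat.factorial k : ℂ)) (n + 1),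
      ← Finset.prod_inv_distrib, ← Matrix.det_mul_row]
    congr 1
    ext i k
    simp only [Matrix.of_apply, A, hdd]
    by_cases hk : k = Fin.last n
    · subst hk
      simp [mul_add]
    · have hk' : (k : ℕ) ≠ n := fun h => hk (Fin.ext h)
      simp [hk, hk']
  have hV : (Matrix.vandermonde x).det =
      ∏ i ∈ range (n + 1), ∏ j ∈ Ioo i (n + 1), (e j - e i) := by
    rw [Matrix.det_vandermonde, ← Fin.prod_univ_eq_prod_range
      (fun i => ∏ j ∈ Ioo i (n + 1), (e j - e i)) (n + 1)]
    refine Finset.prod_congr rfl fun i _ => ?_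
    rw [← Fin.map_valEmbedding_Ioi, Finset.prod_map]
    rfl
  simp only [Nat.add_sub_cancel, hq, mul_comm (n + 1) n]
  refine key.congr_left fun ε => ?_
  rw [hdet, hV, div_eq_mul_inv]
  simp only [F, x]
  ring
end

section
/- Let m ≥ 2, let ū, v̄ : ℂ → ℂ^{m−1} be analytic in a neighborhood of ω ∈ ℂ, let e_1,…,e_m be pairwise distinct complex numbers, let b_1,…,b_m ∈ ℂ, set p_s = (1/(m−1)!)·∏_{i≠s}(e_i − e_s) and ρ_s(ε) = exp(ε^{m−1} p_s b_s), and fix r ∈ {1,…,m}. Let M_r(ε) be the (m−1)×(m−1) matrix whose columns are ū(ω + ε e_s) + ρ_s(ε)·v̄(ω + ε e_s) for s ∈ {1,…,m}\{r} (in increasing order of s). Then, as ε → 0, det M_r(ε) = (ε^{(m−1)(m−2)/2}/(1!·2!·⋯·(m−2)!))·∏_{1≤i<j≤m, i≠r, j≠r}(e_j − e_i)·det(w̄(ω), w̄'(ω), …, w̄^{(m−2)}(ω)) + o(ε^{(m−1)(m−2)/2}), where w̄ = ū + v̄ and derivatives are taken in the variable ω. -/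
open Finset Filter Asymptotics
open scoped Topology

/-- Taylor's theorem with a big-O remainder, for vector-valued analytic functions. -/
theorem AnalyticAt.isBigO_sub_taylor {E : Type*} [NormedAddCommGroup E] [NormedSpace ℂ E]
    [CompleteSpace E] {f : ℂ → E} {x : ℂ} (hf : AnalyticAt ℂ f x) (n : ℕ) :
    (fun h : ℂ => f (x + h) - ∑ k ∈ range n, (h ^ k / (k.factorial : ℂ)) • iteratedDeriv k f x)
      =O[𝓝 0] fun h => h ^ n := by
  obtain ⟨p, R, hp⟩ := hf
  refine ((hp.hasFPowerSeriesAt.isBigO_sub_partialSum_pow n).congr_left fun h => ?_).trans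
    (isBigO_of_le _ fun h => by simp)
  congr 1
  refine Finset.sum_congr rfl fun k _ => ?_
  have hk : (k.factorial : ℂ) ≠ 0 := by exact_mod_cast k.factorial_ne_zero
  have key := hp.factorial_smul h k
  rw [iteratedFDeriv_apply_eq_iteratedDeriv_mul_prod, ← Nat.cast_smul_eq_nsmul ℂ] at key
  simp only [Finset.prod_const, Finset.card_univ, Fintype.card_fin] at key
  rw [div_eq_inv_mul, mul_smul, ← key, smul_smul, inv_mul_cancel₀ hk, one_smul]

/-- If the columns of a matrix `M ε` agree up to `O(ε ^ n)` with the Taylor polynomials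
`∑ k, (ε a_c) ^ k / k! W_k`, then `det (M ε)` is `det W` times a Vandermonde factor, up to a
relative error tending to zero. -/
theorem Matrix.det_sub_vandermonde_isLittleO {n : ℕ} {a : Fin n → ℂ} (ha : Function.Injective a)
    (W : Matrix (Fin n) (Fin n) ℂ) (M : ℂ → Matrix (Fin n) (Fin n) ℂ)
    (hM : ∀ i c, (fun ε : ℂ => M ε i c - ∑ k : Fin n, (ε * a c) ^ (k : ℕ) /
      ((k : ℕ).factorial : ℂ) * W i k) =O[𝓝 0] fun ε => ε ^ n) :
    (fun ε : ℂ => (M ε).det - ε ^ (n * (n - 1) / 2) / (∏ k ∈ range n, (k.factorial : ℂ)) *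
      (∏ i : Fin n, ∏ j ∈ Ioi i, (a j - a i)) * W.det)
      =o[𝓝 (0 : ℂ)] fun ε : ℂ => ε ^ (n * (n - 1) / 2) := by
  have hfac (k : ℕ) : (k.factorial : ℂ) ≠ 0 := by exact_mod_cast k.factorial_ne_zero
  set R : ℂ → Matrix (Fin n) (Fin n) ℂ := fun ε => Matrix.of fun i c =>
    M ε i c - ∑ k : Fin n, (ε * a c) ^ (k : ℕ) / ((k : ℕ).factorial : ℂ) * W i k with hR
  set V := (Matrix.vandermonde a).transpose with hV
  have hVdet : IsUnit V.det := by
    rw [hV, Matrix.det_transpose, isUnit_iff_ne_zero]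
    exact Matrix.det_vandermonde_ne_zero_iff.2 ha
  set T : ℂ → Matrix (Fin n) (Fin n) ℂ := fun ε => W + R ε * V⁻¹ *
    Matrix.diagonal fun k : Fin n => ((k : ℕ).factorial : ℂ) / ε ^ (k : ℕ) with hT
  have hRO (i c : Fin n) : (fun ε => R ε i c) =O[𝓝 0] fun ε : ℂ => ε ^ n := hM i c
  have hR0 : R 0 = 0 := by
    ext i c
    have hn : n ≠ 0 := fun h => (h ▸ i).elim0
    exact ((hRO i c).eq_zero_imp.self_of_nhds) (zero_pow hn)
  have hfactor (ε : ℂ) : M ε =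
      T ε * (Matrix.diagonal fun k : Fin n => ε ^ (k : ℕ) / ((k : ℕ).factorial : ℂ)) * V := by
    have hWV : M ε = W * (Matrix.diagonal fun k : Fin n => ε ^ (k : ℕ) /
        ((k : ℕ).factorial : ℂ)) * V + R ε := by
      ext i c
      rw [Matrix.add_apply, Matrix.mul_apply]
      simp only [hR, hV, Matrix.of_apply, Matrix.mul_diagonal, Matrix.transpose_apply,
        Matrix.vandermonde_apply]
      rw [← sub_eq_iff_eq_add', sub_right_inj]
      refine Finset.sum_congr rfl fun k _ => ?_
      rw [mul_pow]; ring
    by_cases hε : ε = 0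
    · subst hε
      rw [hWV, hT]
      simp [hR0]
    · rw [hWV, hT]
      simp only [add_mul]
      congr 1
      rw [Matrix.mul_assoc (R ε * V⁻¹), Matrix.diagonal_mul_diagonal]
      have : (fun k : Fin n => ((k : ℕ).factorial : ℂ) / ε ^ (k : ℕ) *
          (ε ^ (k : ℕ) / ((k : ℕ).factorial : ℂ))) = fun _ => 1 := by
        funext k
        have := hfac k
        field_simp
      rw [this, Matrix.diagonal_one, Matrix.mul_one, Matrix.mul_assoc,
        Matrix.nonsing_inv_mul _ hVdet, Matrix.mul_one]
  have hTlim : Tendsto (fun ε => (T ε).det) (𝓝 0) (𝓝 W.det) := by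
    refine ((continuous_id.matrix_det (R := ℂ) (n := Fin n)).tendsto W).comp ?_
    refine tendsto_pi_nhds.2 fun i => tendsto_pi_nhds.2 fun k => ?_
    have hterm (c : Fin n) : Tendsto (fun ε => R ε i c / ε ^ (k : ℕ)) (𝓝 0) (𝓝 0) :=
      ((hRO i c).trans_isLittleO (isLittleO_pow_pow k.2)).tendsto_div_nhds_zero
    have hsum : Tendsto (fun ε => W i k + ∑ c, R ε i c / ε ^ (k : ℕ) *
        (V⁻¹ c k * ((k : ℕ).factorial : ℂ))) (𝓝 0) (𝓝 (W i k + ∑ c : Fin n, 0 *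
          (V⁻¹ c k * ((k : ℕ).factorial : ℂ)))) :=
      tendsto_const_nhds.add (tendsto_finsetSum _ fun c _ => (hterm c).mul_const _)
    simp only [zero_mul, Finset.sum_const_zero, add_zero] at hsum
    refine hsum.congr fun ε => ?_
    simp only [Matrix.add_apply, Matrix.mul_diagonal, Matrix.mul_apply (M := R ε),
      Finset.sum_mul]
    congr 1
    exact Finset.sum_congr rfl fun c _ => by ring
  have hpow (ε : ℂ) : ∏ k : Fin n, (ε ^ (k : ℕ) / ((k : ℕ).factorial : ℂ)) =
      ε ^ (n * (n - 1) / 2) / ∏ k ∈ range n, (k.factorial : ℂ) := by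
    rw [Fin.prod_univ_eq_prod_range (fun k => ε ^ k / (k.factorial : ℂ)), Finset.prod_div_distrib,
      Finset.prod_pow_eq_pow_sum, Finset.sum_range_id]
  have hdet (ε : ℂ) : (M ε).det - ε ^ (n * (n - 1) / 2) / (∏ k ∈ range n, (k.factorial : ℂ)) *
      (∏ i : Fin n, ∏ j ∈ Ioi i, (a j - a i)) * W.det =
      ((T ε).det - W.det) * (∏ k ∈ range n, (k.factorial : ℂ))⁻¹ * V.det *
        ε ^ (n * (n - 1) / 2) := by
    rw [hfactor, Matrix.det_mul, Matrix.det_mul, Matrix.det_diagonal, hpow,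
      ← Matrix.det_vandermonde, hV, Matrix.det_transpose]
    ring
  simp only [hdet]
  have hlim : Tendsto (fun ε => ((T ε).det - W.det) * (∏ k ∈ range n, (k.factorial : ℂ))⁻¹ *
      V.det) (𝓝 0) (𝓝 0) := by
    simpa using ((hTlim.sub_const W.det).mul_const _).mul_const V.det
  simpa using ((isLittleO_one_iff ℂ).2 hlim).mul_isBigO
    (isBigO_refl (fun ε : ℂ => ε ^ (n * (n - 1) / 2)) (𝓝 0))

/-- Products over increasing pairs in `{0, …, n} \ {r}`, listed through the increasing
enumeration of this set. -/
theorem Finset.prod_erase_range_pairs (n r : ℕ) (hr : r < n + 1) (g : ℕ → ℕ → ℂ) :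
    ∏ i ∈ (range (n + 1)).erase r, ∏ j ∈ (Ioo i (n + 1)).erase r, g i j =
      ∏ i : Fin n, ∏ j ∈ Ioi i, g (if (i : ℕ) < r then (i : ℕ) else (i : ℕ) + 1)
        (if (j : ℕ) < r then (j : ℕ) else (j : ℕ) + 1) := by
  have hinv (x : ℕ) (hx : x < n + 1) (hxr : x ≠ r) : ∃ c : Fin n,
      (if (c : ℕ) < r then (c : ℕ) else (c : ℕ) + 1) = x :=
    ⟨⟨if x < r then x else x - 1, by split_ifs <;> omega⟩, by dsimp only; split_ifs <;> omega⟩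
  symm
  refine Finset.prod_bij (fun i _ => if (i : ℕ) < r then (i : ℕ) else (i : ℕ) + 1) ?_ ?_ ?_ ?_
  · intro i _
    simp only [mem_erase, mem_range]
    split_ifs <;> omega
  · intro i _ j _ h
    ext
    split_ifs at h <;> omega
  · intro x hx
    obtain ⟨hxr, hx⟩ := mem_erase.1 hx
    obtain ⟨c, hc⟩ := hinv x (mem_range.1 hx) hxr
    exact ⟨c, mem_univ _, hc⟩
  · intro i _
    refine Finset.prod_bij (fun j _ => if (j : ℕ) < r then (j : ℕ) else (j : ℕ) + 1) ?_ ?_ ?_ ?_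
    · intro j hj
      have : i < j := mem_Ioi.1 hj
      rw [Fin.lt_def] at this
      simp only [mem_erase, mem_Ioo]
      split_ifs <;> omega
    · intro j _ k _ h
      ext
      split_ifs at h <;> omega
    · intro x hx
      obtain ⟨hxr, hx⟩ := mem_erase.1 hx
      obtain ⟨c, hc⟩ := hinv x (mem_Ioo.1 hx).2 hxr
      refine ⟨c, ?_, hc⟩
      have := (mem_Ioo.1 hx).1
      rw [← hc] at this
      rw [mem_Ioi, Fin.lt_def]
      split_ifs at this <;> omega
    · intro j _
      rfl

/-- Taylor expansion of `u (ω + ε a) + exp (ε ^ n q) v (ω + ε a)`: up to order `n` the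
exponential factor is invisible. -/
theorem isBigO_add_exp_mul_sub_taylor {n : ℕ} {ω : ℂ} {u v : ℂ → Fin n → ℂ}
    (hu : AnalyticAt ℂ u ω) (hv : AnalyticAt ℂ v ω) (a p b : ℂ) (i : Fin n) :
    (fun ε : ℂ => u (ω + ε * a) i + Complex.exp (ε ^ n * p * b) * v (ω + ε * a) i -
      ∑ k : Fin n, (ε * a) ^ (k : ℕ) / ((k : ℕ).factorial : ℂ) *
        iteratedDeriv (k : ℕ) (fun z => u z + v z) ω i) =O[𝓝 0] fun ε => ε ^ n := by
  have hn : n ≠ 0 := fun h => (h ▸ i).elim0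
  have hlin : Tendsto (fun ε : ℂ => ε * a) (𝓝 0) (𝓝 0) := by
    simpa using (tendsto_id (x := 𝓝 (0 : ℂ))).mul_const a
  have htaylor := ((hu.add hv).isBigO_sub_taylor n).comp_tendsto hlin
  have hcoord : (fun ε : ℂ => (u (ω + ε * a) + v (ω + ε * a) - ∑ k ∈ range n,
      ((ε * a) ^ k / (k.factorial : ℂ)) • iteratedDeriv k (fun z => u z + v z) ω) i)
      =O[𝓝 0] fun ε : ℂ => ε ^ n := by
    refine (isBigO_pi.1 htaylor i).trans ?_
    exact (((isBigO_refl (fun ε : ℂ => ε) (𝓝 0)).const_mul_left a).pow n).congr_left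
      fun ε => by simp only [Function.comp_apply, mul_comm]
  have hexp : (fun ε : ℂ => Complex.exp (ε ^ n * p * b) - 1) =O[𝓝 0] fun ε : ℂ => ε ^ n := by
    have hz : Tendsto (fun ε : ℂ => ε ^ n * p * b) (𝓝 0) (𝓝 0) := by
      have : Continuous fun ε : ℂ => ε ^ n * p * b := by fun_prop
      simpa [hn] using this.tendsto 0
    have hexp0 : (fun z : ℂ => Complex.exp z - 1) =O[𝓝 0] fun z => z := by
      simpa using (Complex.hasDerivAt_exp 0).differentiableAt.isBigO_sub
    refine (hexp0.comp_tendsto hz).trans ?_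
    exact ((isBigO_refl (fun ε : ℂ => ε ^ n) (𝓝 0)).const_mul_left (p * b)).congr_left
      fun ε => by simp only [Function.comp_apply]; ring
  have hvb : (fun ε : ℂ => v (ω + ε * a) i) =O[𝓝 0] fun _ => (1 : ℂ) := by
    have hω : Tendsto (fun ε : ℂ => ω + ε * a) (𝓝 0) (𝓝 ω) := by
      simpa using hlin.const_add ω
    exact ((tendsto_pi_nhds.1 (hv.continuousAt.tendsto.comp hω)) i).isBigO_one ℂ
  refine (hcoord.add ((hexp.mul hvb).congr_right fun ε => mul_one _)).congr_left fun ε => ?_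
  simp only [Pi.sub_apply, Pi.add_apply, Finset.sum_apply, Pi.smul_apply, smul_eq_mul]
  rw [← Fin.sum_univ_eq_sum_range
    (fun k => (ε * a) ^ k / (k.factorial : ℂ) * iteratedDeriv k (fun z => u z + v z) ω i)]
  ring

/-- the second key determinant expansion of the generalized
forward Darboux transformation, for the `(m−1)×(m−1)` determinant with the
`r`-th column removed. With `ρ_s(ε) = exp(ε^{m−1} p_s b_s)`,
`p_s = (1/(m−1)!) ∏_{i≠s}(e_i − e_s)`, and `M_r(ε)` the matrix whose columns are
`ū(ω + ε e_s) + ρ_s(ε) v̄(ω + ε e_s)` for `s ≠ r` in increasing order, as `ε → 0`: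
`det M_r(ε) = (ε^{(m−1)(m−2)/2}/(1!⋯(m−2)!)) ∏_{i<j, i≠r, j≠r}(e_j − e_i) ·
det(w̄, w̄', …, w̄^{(m−2)}) + o(ε^{(m−1)(m−2)/2})`, where `w̄ = ū + v̄`.
(Indices run over `0,…,m−1` here, the omitted column index being `r < m`.) -/
theorem det_expansion_omitted_column
    (m : ℕ) (hm : 2 ≤ m) (ω : ℂ)
    (ub vb : ℂ → Fin (m - 1) → ℂ)
    (hu : AnalyticAt ℂ ub ω) (hv : AnalyticAt ℂ vb ω)
    (e b : ℕ → ℂ)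
    (he : ∀ i < m, ∀ j < m, i ≠ j → e i ≠ e j)
    (r : ℕ) (hr : r < m) :
    (fun ε : ℂ =>
        Matrix.det (Matrix.of fun (i c : Fin (m - 1)) =>
          ub (ω + ε * e (if (c : ℕ) < r then (c : ℕ) else (c : ℕ) + 1)) i
            + Complex.exp (ε ^ (m - 1) *
                (((Nat.factorial (m - 1) : ℂ))⁻¹ *
                  ∏ k ∈ (Finset.range m).erase
                      (if (c : ℕ) < r then (c : ℕ) else (c : ℕ) + 1),
                    (e k - e (if (c : ℕ) < r then (c : ℕ) else (c : ℕ) + 1))) *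
                b (if (c : ℕ) < r then (c : ℕ) else (c : ℕ) + 1)) *
              vb (ω + ε * e (if (c : ℕ) < r then (c : ℕ) else (c : ℕ) + 1)) i)
      - ε ^ ((m - 1) * (m - 2) / 2) / (∏ k ∈ range (m - 1), (Nat.factorial k : ℂ)) *
          (∏ i ∈ (Finset.range m).erase r,
            ∏ j ∈ (Finset.Ioo i m).erase r, (e j - e i)) *
          Matrix.det (Matrix.of fun (i k : Fin (m - 1)) =>
            iteratedDeriv (k : ℕ) (fun z => ub z + vb z) ω i))
      =o[𝓝 (0 : ℂ)] fun ε : ℂ => ε ^ ((m - 1) * (m - 2) / 2) := by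
  obtain ⟨n, rfl⟩ : ∃ n, m = n + 1 := ⟨m - 1, by omega⟩
  rw [Finset.prod_erase_range_pairs n r hr (fun i j => e j - e i)]
  refine Matrix.det_sub_vandermonde_isLittleO (n := n)
    (a := fun c => e (if (c : ℕ) < r then (c : ℕ) else (c : ℕ) + 1)) ?_ _ _ ?_
  · intro c d hcd
    by_contra hne
    have hne' : (c : ℕ) ≠ d := fun h => hne (Fin.ext h)
    refine he _ ?_ _ ?_ ?_ hcd <;> split_ifs <;> omega
  · intro i c
    exact isBigO_add_exp_mul_sub_taylor hu hv _ _ _ i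
end

section
/- Let ω, θ ∈ ℝ with θ not an integer multiple of π/2, let β : ℝ → ℝ be differentiable, and define Δ : ℝ × ℝ → ℝ by Δ(y,t) = (y − t cos ω + (1/2) β(t) sin(2θ) + 1/2)·sin ω + (1/2)·sin(2(y ω − t sin ω − θ) + ω). Let n₀ : ℝ → ℝ be differentiable with Δ(n₀(t), t) = 0 for all t, and suppose ω ≠ 0 and sin ω + ω cos(2 n₀(t) ω − 2 t sin ω − 2θ + ω) ≠ 0 for all t. Then for every t, n₀'(t) = (sin ω / ω)·[1 + (ω cos ω − (1/2) ω β'(t) sin(2θ) − sin ω)/(sin ω + ω cos(2 n₀(t) ω − 2 t sin ω − 2θ + ω))]. -/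
open Real

/-- the nonlinear ODE governing the propagation of a
singularity `n₀(t)` of the one-positon profile, obtained by implicit
differentiation of `Δ(n₀(t),t) = 0`, where `Δ(y,t)` is the continuous
extension of the one-positon denominator. -/
theorem positon_singularity_speed
    (ω θ : ℝ) (hθ : ∀ k : ℤ, θ ≠ k * (Real.pi / 2))
    (β : ℝ → ℝ) (hβ : Differentiable ℝ β)
    (Δp : ℝ → ℝ → ℝ)
    (hΔp : ∀ y t : ℝ, Δp y t =
      (y - t * Real.cos ω + (1 / 2) * β t * Real.sin (2 * θ) + 1 / 2) * Real.sin ω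
        + (1 / 2) * Real.sin (2 * (y * ω - t * Real.sin ω - θ) + ω))
    (n₀ : ℝ → ℝ) (hn₀ : Differentiable ℝ n₀)
    (hzero : ∀ t, Δp (n₀ t) t = 0)
    (hω : ω ≠ 0)
    (hden : ∀ t, Real.sin ω
      + ω * Real.cos (2 * n₀ t * ω - 2 * t * Real.sin ω - 2 * θ + ω) ≠ 0) :
    ∀ t : ℝ,
      deriv n₀ t = (Real.sin ω / ω) *
        (1 + (ω * Real.cos ω - (1 / 2) * ω * deriv β t * Real.sin (2 * θ)
                - Real.sin ω) /
          (Real.sin ω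
            + ω * Real.cos (2 * n₀ t * ω - 2 * t * Real.sin ω - 2 * θ + ω))) := by
  intro t
  have hn := (hn₀ t).hasDerivAt
  have hshift := ((hn.sub ((hasDerivAt_id t).mul_const (cos ω))).add
    (((hβ t).hasDerivAt.const_mul (1 / 2)).mul_const (sin (2 * θ)))).add_const (1 / 2)
  have hphase := ((((hn.mul_const ω).sub ((hasDerivAt_id t).mul_const (sin ω))).sub_const
    θ).const_mul 2).add_const ω
  have hderiv := (hshift.mul_const (sin ω)).add (hphase.sin.const_mul (1 / 2))
  have hconst := (hasDerivAt_const t (0 : ℝ)).congr_of_eventuallyEq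
    (Filter.Eventually.of_forall fun s => (hΔp (n₀ s) s).symm.trans (hzero s))
  have hlin := hderiv.unique hconst
  have hangle : 2 * (n₀ t * ω - t * sin ω - θ) + ω
      = 2 * n₀ t * ω - 2 * t * sin ω - 2 * θ + ω := by ring
  simp only [Pi.sub_apply, id_eq, hangle] at hlin
  have hD := hden t
  generalize cos (2 * n₀ t * ω - 2 * t * sin ω - 2 * θ + ω) = C at hlin hD ⊢
  field_simp
  linear_combination 2 * ω * hlin
end
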